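/- arXiv:2004.11304 — 11 statements merged into one kernel-verified Lean document; each statement's English description precedes it below -/
import Mathlib

section
/- Let G be a group and H ≤ G a subgroup of finite index. For every n ∈ ℕ, if (F₂)^n embeds into G, then (F₂)^n embeds into H. Consequently, the free subgroup rank ν is invariant under passing to finite index subgroups. -/
/-- `FreeTorusEmbeds n G` means the direct product of `n` copies of the free group on two
generators embeds into `G`. -/
def FreeTorusEmbeds (n : ℕ) (G : Type*) [Group G] : Prop :=
  ∃ f : (Fin n → FreeGroup (Fin 2)) →* G, Function.Injective f

/-- The free subgroup rank of `G`: the maximal `n` such that `(F₂)^n` embeds into `G`. -/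
noncomputable def freeSubgroupRank (G : Type*) [Group G] : ℕ∞ :=
  sSup {c : ℕ∞ | ∃ n : ℕ, c = n ∧ FreeTorusEmbeds n G}

theorem ft_reduced_flatMap {α : Type*} (k : ℕ) (L : List (α × Bool)) (h : FreeGroup.IsReduced L) :
    FreeGroup.IsReduced (L.flatMap (fun x => List.replicate (k + 1) x)) := by
  unfold FreeGroup.IsReduced at *
  induction L with
  | nil => simp
  | cons x L ih =>
    rw [List.flatMap_cons, List.isChain_append]
    refine ⟨List.isChain_replicate_of_rel _ (fun _ => rfl), ih h.tail, ?_⟩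
    intro a ha b hb
    have ha' : a = x := List.eq_of_mem_replicate (List.mem_of_getLast? ha)
    subst ha'
    cases L with
    | nil => simp at hb
    | cons y L =>
      have hy : b = y := by
        simpa [List.replicate_succ, eq_comm] using hb
      subst hy
      exact (List.isChain_cons_cons.1 h).1

theorem ft_lift_mk {α : Type*} (k : ℕ) (L : List (α × Bool)) :
    FreeGroup.lift (fun a : α => FreeGroup.of a ^ (k + 1)) (FreeGroup.mk L) =
      FreeGroup.mk (L.flatMap (fun x => List.replicate (k + 1) x)) := by
  have hr : ∀ (x : α × Bool) (n : ℕ),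
      FreeGroup.mk (List.replicate n x) = (FreeGroup.mk [x]) ^ n := by
    intro x n
    induction n with
    | zero => simp [FreeGroup.one_eq_mk]
    | succ n ih => rw [pow_succ', ← ih, FreeGroup.mul_mk]; rfl
  induction L with
  | nil => simp [← FreeGroup.one_eq_mk]
  | cons x L ih =>
    rw [List.flatMap_cons, ← FreeGroup.mul_mk, ← ih, hr, FreeGroup.lift_mk, FreeGroup.lift_mk,
      List.map_cons, List.prod_cons]
    congr 1
    obtain ⟨a, b⟩ := x
    cases b
    · show (FreeGroup.of a ^ (k + 1))⁻¹ = _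
      rw [← inv_pow]; rfl
    · rfl

theorem ft_lift_injective {α : Type*} [DecidableEq α] (m : ℕ) (hm : m ≠ 0) :
    Function.Injective (FreeGroup.lift (fun a : α => FreeGroup.of a ^ m)) := by
  obtain ⟨k, rfl⟩ := Nat.exists_eq_succ_of_ne_zero hm
  rw [injective_iff_map_eq_one]
  intro w hw
  rw [← FreeGroup.mk_toWord (x := w)] at hw
  rw [Nat.succ_eq_add_one, ft_lift_mk] at hw
  have h2 := congrArg FreeGroup.toWord hw
  rw [FreeGroup.toWord_mk, (ft_reduced_flatMap k _ FreeGroup.isReduced_toWord).reduce_eq,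
    FreeGroup.toWord_one] at h2
  rw [← FreeGroup.toWord_eq_nil_iff]
  cases h : w.toWord with
  | nil => rfl
  | cons x L => rw [h] at h2; simp [List.replicate_succ] at h2

theorem ft_embeds {G : Type*} [Group G] (H : Subgroup G) (hH : H.FiniteIndex) (n : ℕ)
    (h : FreeTorusEmbeds n G) : FreeTorusEmbeds n H := by
  obtain ⟨f, hf⟩ := h
  have hpow : ∀ g : G, g ^ (H.index.factorial) ∈ H := fun g =>
    H.pow_mem_of_index_ne_zero_of_dvd hH.index_ne_zero g
      (fun m h0 h1 => Nat.dvd_factorial h0 h1)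
  have hm := Nat.factorial_ne_zero H.index
  generalize H.index.factorial = m at hpow hm
  let φ : FreeGroup (Fin 2) →* FreeGroup (Fin 2) :=
    FreeGroup.lift (fun a => FreeGroup.of a ^ m)
  have hφ : Function.Injective φ := ft_lift_injective m hm
  let Φ : (Fin n → FreeGroup (Fin 2)) →* (Fin n → FreeGroup (Fin 2)) :=
    { toFun := fun x i => φ (x i)
      map_one' := by ext i; simp
      map_mul' := by intro x y; funext i; simp }
  have hmem : ∀ x, f (Φ x) ∈ H := by
    intro x
    change Φ x ∈ H.comap f
    apply Subgroup.pi_mem_of_mulSingle_mem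
    intro i
    change Pi.mulSingle i (φ (x i)) ∈ H.comap f
    have : φ.range ≤ (H.comap f).comap
        (MonoidHom.mulSingle (fun _ : Fin n => FreeGroup (Fin 2)) i) := by
      apply FreeGroup.range_lift_le
      rintro _ ⟨a, rfl⟩
      simp only [SetLike.mem_coe, Subgroup.mem_comap, map_pow]
      exact hpow _
    exact this ⟨x i, rfl⟩
  refine ⟨(f.comp Φ).codRestrict H hmem, ?_⟩
  intro x y hxy
  have h1 : f (Φ x) = f (Φ y) := congrArg Subtype.val hxy
  funext i
  exact hφ (congrFun (hf h1) i)

theorem finite_index_free_torus {G : Type*} [Group G] (H : Subgroup G) (hH : H.FiniteIndex) :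
    (∀ n : ℕ, FreeTorusEmbeds n G → FreeTorusEmbeds n H) ∧
      freeSubgroupRank H = freeSubgroupRank G := by
  refine ⟨ft_embeds H hH, ?_⟩
  have : ∀ n, FreeTorusEmbeds n H ↔ FreeTorusEmbeds n G := fun n =>
    ⟨fun ⟨f, hf⟩ => ⟨H.subtype.comp f, H.subtype_injective.comp hf⟩, ft_embeds H hH n⟩
  simp only [freeSubgroupRank, this]
end

section
/- For arbitrary groups G₁ and G₂ and every n ∈ ℕ, the group (F₂)^n embeds into the direct product G₁ × G₂ if and only if there exists 0 ≤ k ≤ n such that (F₂)^k embeds into G₁ and (F₂)^{n−k} embeds into G₂. In particular, ν(G₁ × G₂) = ν(G₁) + ν(G₂). -/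
lemma FTE_subsingleton {ι : Type*} (h : ∀ a b : FreeGroup ι, a * b = b * a) (i j : ι) : i = j := by
  classical
  by_contra hij
  have h1 := congrArg (FreeGroup.lift (fun k => if k = i then Equiv.swap (0 : Fin 3) 1
    else Equiv.swap (1 : Fin 3) 2)) (h (FreeGroup.of i) (FreeGroup.of j))
  have hji : ¬ j = i := fun e => hij e.symm
  simp only [map_mul, FreeGroup.lift_apply_of, if_true, if_neg hji] at h1
  revert h1
  decide

lemma FTE_zpow {ι : Type*} (i : ι) (h : ∀ j, j = i) (w : FreeGroup ι) :
    ∃ n : ℤ, FreeGroup.of i ^ n = w := by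
  change w ∈ Subgroup.zpowers (FreeGroup.of i)
  induction w using FreeGroup.induction_on with
  | C1 => exact one_mem _
  | of j => rw [h j]; exact Subgroup.mem_zpowers _
  | inv_of j hj => exact inv_mem hj
  | mul a b ha hb => exact mul_mem ha hb

lemma FTE_comm {α : Type} (x y : FreeGroup α) (hxy : x * y = y * x) (hx : x ≠ 1) (hy : y ≠ 1) :
    ∃ p q : ℤ, p ≠ 0 ∧ q ≠ 0 ∧ x ^ p = y ^ q := by
  classical
  let H : Subgroup (FreeGroup α) := Subgroup.closure {x, y}
  have hc : ∀ a b : H, a * b = b * a := by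
    have : IsMulCommutative H := by
      apply Subgroup.isMulCommutative_closure
      rintro a (rfl | rfl) b (rfl | rfl) <;> first | rfl | exact hxy | exact hxy.symm
    exact fun a b => this.is_comm.comm a b
  obtain ⟨ι, ⟨⟨e⟩⟩⟩ := (inferInstance : IsFreeGroup H).nonempty_basis
  have hs := FTE_subsingleton (ι := ι) (fun a b => by
    have := congrArg e (hc (e.symm a) (e.symm b))
    simpa using this)
  let x' : H := ⟨x, Subgroup.subset_closure (by simp)⟩
  let y' : H := ⟨y, Subgroup.subset_closure (by simp)⟩
  rcases isEmpty_or_nonempty ι with hι | ⟨⟨i⟩⟩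
  · exfalso
    have : e x' = e 1 := Subsingleton.elim _ _
    exact hx (congrArg Subtype.val (e.injective this))
  obtain ⟨a, ha⟩ := FTE_zpow i (fun j => hs j i) (e x')
  obtain ⟨b, hb⟩ := FTE_zpow i (fun j => hs j i) (e y')
  refine ⟨b, a, ?_, ?_, ?_⟩
  · rintro rfl
    have : y' = 1 := e.injective (by rw [← hb]; simp)
    exact hy (congrArg Subtype.val this)
  · rintro rfl
    have : x' = 1 := e.injective (by rw [← ha]; simp)
    exact hx (congrArg Subtype.val this)
  · have : x' ^ b = y' ^ a := by
      apply e.injective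
      rw [map_zpow, map_zpow, ← ha, ← hb, ← zpow_mul, ← zpow_mul, mul_comm]
    exact congrArg Subtype.val this

lemma FTE_center (z : FreeGroup (Fin 2)) (hz : ∀ g, z * g = g * z) : z = 1 := by
  by_contra h1
  obtain ⟨p, q, hp, hq, h⟩ := FTE_comm z (FreeGroup.of 0) (hz _) h1 (FreeGroup.of_ne_one _)
  obtain ⟨r, s, hr, hs, h'⟩ := FTE_comm z (FreeGroup.of 1) (hz _) h1 (FreeGroup.of_ne_one _)
  let φ : FreeGroup (Fin 2) →* Multiplicative ℤ :=
    FreeGroup.lift ![Multiplicative.ofAdd 1, 1]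
  have e1 := congrArg Multiplicative.toAdd (congrArg φ h)
  have e2 := congrArg Multiplicative.toAdd (congrArg φ h')
  simp [φ] at e1 e2
  rcases e2 with e2 | e2
  · exact hr e2
  · rw [e2] at e1
    simp at e1
    exact hq e1.symm

lemma FTE_normal (M N : Subgroup (FreeGroup (Fin 2))) [M.Normal] [N.Normal]
    (h : ∀ x, x ∈ M → x ∈ N → x = 1) : (∀ x ∈ M, x = 1) ∨ (∀ x ∈ N, x = 1) := by
  by_contra! hc
  obtain ⟨⟨m, hm, hm1⟩, ⟨n, hn, hn1⟩⟩ := hc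
  have hd : Disjoint M N := by
    rw [Subgroup.disjoint_def]; exact fun {x} a b => h x a b
  have hcm : Commute m n := Subgroup.commute_of_normal_of_disjoint M N ‹_› ‹_› hd m n hm hn
  obtain ⟨p, q, hp, hq, e⟩ := FTE_comm m n hcm hm1 hn1
  have := h (m ^ p) (zpow_mem hm p) (e ▸ zpow_mem hn q)
  exact hm1 ((IsMulTorsionFree.zpow_eq_one_iff_left hp).1 this)

lemma FTE_reindex {ι : Type*} [Fintype ι] {G : Type*} [Group G]
    (f : (ι → FreeGroup (Fin 2)) →* G) (hf : Function.Injective f) :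
    FreeTorusEmbeds (Fintype.card ι) G := by
  let e := Fintype.equivFin ι
  refine ⟨f.comp ⟨⟨fun x i => x (e i), rfl⟩, fun _ _ => rfl⟩, ?_⟩
  intro x y hxy
  have := hf hxy
  funext i
  simpa using congrFun this (e.symm i)

lemma FTE_restrict {n : ℕ} {G : Type*} [Group G] (f : (Fin n → FreeGroup (Fin 2)) →* G)
    (P : Fin n → Prop) [DecidablePred P]
    (h : ∀ i, P i → ∀ g, f (Pi.mulSingle i g) = 1 → g = 1) :
    FreeTorusEmbeds (Fintype.card {i // P i}) G := by
  let E : ({i // P i} → FreeGroup (Fin 2)) →* (Fin n → FreeGroup (Fin 2)) :=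
    Function.ExtendByOne.hom _ Subtype.val
  have hE : ∀ x (i : {i // P i}), E x i = x i := fun x i =>
    Subtype.val_injective.extend_apply _ _ _
  refine FTE_reindex (f.comp E) ?_
  rw [injective_iff_map_eq_one]
  intro x hx
  funext i
  apply FTE_center
  intro g
  have key := h i i.2 (x i * g * (x i)⁻¹ * g⁻¹) (by
    have : (Pi.mulSingle (i : Fin n) (x i * g * (x i)⁻¹ * g⁻¹) : Fin n → FreeGroup (Fin 2)) =
        E x * Pi.mulSingle (i : Fin n) g * (E x)⁻¹ * (Pi.mulSingle (i : Fin n) g)⁻¹ := by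
      funext j
      by_cases hj : j = i
      · subst hj; simp [hE]
      · simp [Pi.mulSingle_eq_of_ne hj]
    have hx' : f (E x) = 1 := hx
    rw [this]
    simp [hx'])
  rw [mul_inv_eq_one, mul_inv_eq_iff_eq_mul] at key
  exact key

lemma FTE_iff {G₁ G₂ : Type*} [Group G₁] [Group G₂] (n : ℕ) : FreeTorusEmbeds n (G₁ × G₂) ↔
      ∃ k, k ≤ n ∧ FreeTorusEmbeds k G₁ ∧ FreeTorusEmbeds (n - k) G₂ := by
  classical
  constructor
  · rintro ⟨f, hf⟩
    let f₁ := (MonoidHom.fst G₁ G₂).comp f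
    let f₂ := (MonoidHom.snd G₁ G₂).comp f
    let P : Fin n → Prop := fun i => ∀ g, f₁ (Pi.mulSingle i g) = 1 → g = 1
    have h2 : ∀ i, ¬ P i → ∀ g, f₂ (Pi.mulSingle i g) = 1 → g = 1 := by
      intro i hi
      let s := MonoidHom.mulSingle (fun _ : Fin n => FreeGroup (Fin 2)) i
      rcases FTE_normal (f₁.comp s).ker (f₂.comp s).ker (fun x h1 h2 => by
        have : f (Pi.mulSingle i x) = 1 := Prod.ext h1 h2
        have := (injective_iff_map_eq_one f).1 hf _ this
        simpa using this) with h | h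
      · exact absurd (fun g hg => h g hg) hi
      · exact fun g hg => h g hg
    have E1 := FTE_restrict f₁ P (fun i hi => hi)
    have E2 := FTE_restrict f₂ (fun i => ¬ P i) h2
    rw [Fintype.card_subtype_compl, Fintype.card_fin] at E2
    refine ⟨_, ?_, E1, E2⟩
    simpa using Fintype.card_subtype_le P
  · rintro ⟨k, hk, ⟨f, hf⟩, h2⟩
    obtain ⟨m, rfl⟩ := Nat.exists_eq_add_of_le hk
    rw [Nat.add_sub_cancel_left] at h2
    obtain ⟨g, hg⟩ := h2
    let r₁ : (Fin (k + m) → FreeGroup (Fin 2)) →* (Fin k → FreeGroup (Fin 2)) :=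
      ⟨⟨fun x i => x (Fin.castAdd m i), rfl⟩, fun _ _ => rfl⟩
    let r₂ : (Fin (k + m) → FreeGroup (Fin 2)) →* (Fin m → FreeGroup (Fin 2)) :=
      ⟨⟨fun x i => x (Fin.natAdd k i), rfl⟩, fun _ _ => rfl⟩
    refine ⟨(f.comp r₁).prod (g.comp r₂), ?_⟩
    intro x y hxy
    have h1 := hf (congrArg Prod.fst hxy)
    have h2 := hg (congrArg Prod.snd hxy)
    funext i
    refine Fin.addCases (fun i => ?_) (fun i => ?_) i
    · exact congrFun h1 i
    · exact congrFun h2 i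

theorem free_torus_embeds_prod_iff {G₁ G₂ : Type*} [Group G₁] [Group G₂] :
    (∀ n : ℕ, FreeTorusEmbeds n (G₁ × G₂) ↔
      ∃ k, k ≤ n ∧ FreeTorusEmbeds k G₁ ∧ FreeTorusEmbeds (n - k) G₂) ∧
    freeSubgroupRank (G₁ × G₂) = freeSubgroupRank G₁ + freeSubgroupRank G₂ := by
  refine ⟨FTE_iff, ?_⟩
  have hne : ∀ (G : Type _) [Group G],
      ({c : ℕ∞ | ∃ n : ℕ, c = n ∧ FreeTorusEmbeds n G}).Nonempty := fun G _ =>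
    ⟨0, 0, rfl, 1, fun x y _ => Subsingleton.elim x y⟩
  have hne2 : ({c : ℕ∞ | ∃ n : ℕ, c = n ∧ FreeTorusEmbeds n G₂}).Nonempty :=
    ⟨0, 0, rfl, 1, fun x y _ => Subsingleton.elim x y⟩
  apply le_antisymm
  · refine sSup_le ?_
    rintro _ ⟨n, rfl, hn⟩
    obtain ⟨k, hk, h1, h2⟩ := (FTE_iff n).1 hn
    calc (n : ℕ∞) = (k : ℕ∞) + ((n - k : ℕ) : ℕ∞) := by
          rw [← Nat.cast_add, Nat.add_sub_cancel' hk]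
      _ ≤ freeSubgroupRank G₁ + freeSubgroupRank G₂ := add_le_add (le_sSup ⟨k, rfl, h1⟩) (le_sSup ⟨_, rfl, h2⟩)
  · unfold freeSubgroupRank
    rw [sSup_eq_iSup, sSup_eq_iSup]
    refine ENat.biSup_add_biSup_le (hne G₁) hne2 ?_
    rintro _ ⟨k, rfl, h1⟩ _ ⟨m, rfl, h2⟩
    refine le_sSup ⟨k + m, by push_cast; rfl, (FTE_iff _).2 ⟨k, by omega, h1, ?_⟩⟩
    rwa [Nat.add_sub_cancel_left]
end

section
/- If K is a subgroup of a direct product G₁ × G₂ of groups and K is isomorphic to F₂, then the restriction to K of the projection onto G₁ is injective, or the restriction to K of the projection onto G₂ is injective. -/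
theorem freeGroup_comm_common_root {α : Type} (x y : FreeGroup α) (h : x * y = y * x) :
    ∃ (c : FreeGroup α) (i j : ℤ), x = c ^ i ∧ y = c ^ j := by
  classical
  let H : Subgroup (FreeGroup α) := Subgroup.closure {x, y}
  have hx : x ∈ H := Subgroup.subset_closure (by simp)
  have hy : y ∈ H := Subgroup.subset_closure (by simp)
  have hcomm : ∀ a ∈ H, ∀ b ∈ H, a * b = b * a := by
    have hle : H ≤ Subgroup.centralizer (H : Set (FreeGroup α)) := by
      have h1 : H ≤ Subgroup.centralizer ({x, y} : Set (FreeGroup α)) := by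
        rw [Subgroup.closure_le]
        rintro a (rfl | rfl) <;> simp [Subgroup.mem_centralizer_iff, h]
      rw [Subgroup.closure_le]
      rintro a ha
      rw [SetLike.mem_coe, Subgroup.mem_centralizer_iff]
      intro b hb
      exact (Subgroup.mem_centralizer_iff.1 (h1 hb) a ha).symm
    intro a ha b hb
    exact (Subgroup.mem_centralizer_iff.1 (hle ha) b hb).symm
  let e : FreeGroup (IsFreeGroup.Generators H) ≃* H := IsFreeGroup.mulEquiv H
  have hc : ∀ a b : FreeGroup (IsFreeGroup.Generators H), a * b = b * a := by
    intro a b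
    apply e.injective
    rw [map_mul, map_mul]
    exact Subtype.ext (hcomm _ (e a).2 _ (e b).2)
  have hsub : Subsingleton (IsFreeGroup.Generators H) := by
    refine ⟨fun s t => ?_⟩
    by_contra hst
    have := congrArg FreeGroup.toWord (hc (FreeGroup.of s) (FreeGroup.of t))
    simp [FreeGroup.toWord_mul, FreeGroup.reduce.cons] at this
    exact hst this.1
  have key : ∃ c : FreeGroup (IsFreeGroup.Generators H), ∀ z, z ∈ Subgroup.zpowers c := by
    rcases isEmpty_or_nonempty (IsFreeGroup.Generators H) with hE | ⟨⟨s⟩⟩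
    · exact ⟨1, fun z => by rw [Subsingleton.elim z 1]; exact Subgroup.one_mem _⟩
    · refine ⟨FreeGroup.of s, fun z => ?_⟩
      have h2 : Subgroup.closure (Set.range FreeGroup.of) ≤ Subgroup.zpowers (FreeGroup.of s) := by
        rw [Subgroup.closure_le]
        rintro _ ⟨t, rfl⟩
        rw [Subsingleton.elim t s]
        exact Subgroup.mem_zpowers _
      apply h2
      rw [FreeGroup.closure_range_of]
      trivial
  obtain ⟨c, hcz⟩ := key
  have aux : ∀ w (hw : w ∈ H), ∃ i : ℤ, w = ((e c : H) : FreeGroup α) ^ i := by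
    intro w hw
    obtain ⟨i, hi⟩ := Subgroup.mem_zpowers_iff.1 (hcz (e.symm ⟨w, hw⟩))
    refine ⟨i, ?_⟩
    have h3 := congrArg (fun u => ((e u : H) : FreeGroup α)) hi
    simpa using h3.symm
  obtain ⟨i, hi⟩ := aux x hx
  obtain ⟨j, hj⟩ := aux y hy
  exact ⟨_, i, j, hi, hj⟩

theorem free_subgroup_of_prod_projects_injectively {G₁ G₂ : Type*} [Group G₁] [Group G₂]
    (K : Subgroup (G₁ × G₂)) (e : K ≃* FreeGroup (Fin 2)) :
    Function.Injective ((MonoidHom.fst G₁ G₂).comp K.subtype) ∨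
      Function.Injective ((MonoidHom.snd G₁ G₂).comp K.subtype) := by
  by_contra hcon
  rw [not_or, injective_iff_map_eq_one, injective_iff_map_eq_one] at hcon
  push Not at hcon
  obtain ⟨⟨a, ha, ha1⟩, ⟨b, hb, hb1⟩⟩ := hcon
  have ha' : (a : G₁ × G₂).1 = 1 := ha
  have hb' : (b : G₁ × G₂).2 = 1 := hb
  have hab : a * b = b * a := by
    apply Subtype.ext
    apply Prod.ext <;> simp [ha', hb']
  obtain ⟨c, i, j, hi, hj⟩ := freeGroup_comm_common_root (e a) (e b)
    (by rw [← map_mul, hab, map_mul])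
  have hpow : a ^ j = b ^ i := by
    apply e.injective
    rw [map_zpow, map_zpow, hi, hj, ← zpow_mul, ← zpow_mul, mul_comm]
  have h1 : a ^ j = 1 := by
    apply Subtype.ext
    apply Prod.ext
    · simp [ha']
    · rw [hpow]; simp [hb']
  have h2 : (e a) ^ j = 1 := by rw [← map_zpow, h1, map_one]
  have hj0 : j ≠ 0 := by
    rintro rfl
    apply hb1
    apply e.injective
    rw [hj, zpow_zero, map_one]
  have h3 : e a = 1 := zpow_left_injective hj0 (by simpa using h2)
  exact ha1 (e.injective (by rw [h3, map_one]))
end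

section
/- Let G₁ and G₂ be nontrivial groups that are not both of order two. Then F₂ embeds into the free product G₁ ∗ G₂. -/
open Monoid Monoid.CoprodI in
theorem ff_core.{u} {ι : Type} {M : ι → Type u} [∀ i, Group (M i)] {i j : ι} (hij : i ≠ j)
    {a b : M i} {c : M j} (ha : a ≠ 1) (hb : b ≠ 1) (hab : a ≠ b) (hc : c ≠ 1) :
    Function.Injective (FreeGroup.lift (fun t : ULift.{u} (Fin 2) =>
      if t.down = 0 then (of a * of c * of a⁻¹ * of c⁻¹ : CoprodI M)
      else of b * of c * of b⁻¹ * of c⁻¹)) := by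
  classical
  let hd : ∀ k, Word M → M k := fun k w => (Word.equivPair k w).head
  have h1 : ∀ k (m : M k) (w : Word M), hd k ((of m : CoprodI M) • w) = m * hd k w := by
    intro k m w
    change (Word.equivPair k ((of m : CoprodI M) • w)).head = _
    rw [Word.equivPair_smul_same]
  have h2 : ∀ k l, k ≠ l → ∀ w : Word M, hd k w ≠ 1 → hd l w = 1 := by
    intro k l hkl w hw
    simp only [hd, Word.equivPair_head] at hw ⊢
    split_ifs at hw with h
    · obtain ⟨hn, hk⟩ := h
      rw [dif_neg]
      rintro ⟨hn', hl⟩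
      exact hkl (hk.symm.trans hl)
    · exact absurd rfl hw
  let P : ∀ k l, M k → M l → Set (Word M) := fun k l x y =>
    {w | hd k w = x ∧ hd l ((of x⁻¹ : CoprodI M) • w) = y}
  have key : ∀ k l, k ≠ l → ∀ (x : M k) (y : M l), x ≠ 1 → y ≠ 1 → ∀ w, w ∉ P l k y x →
      (of x * of y * of x⁻¹ * of y⁻¹ : CoprodI M) • w ∈ P k l x y := by
    intro k l hkl x y hx hy w hw
    have e1 : hd k ((of y⁻¹ : CoprodI M) • w) ≠ x := by
      intro he
      by_cases hyw : hd l w = y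
      · exact hw ⟨hyw, he⟩
      · have : hd k ((of y⁻¹ : CoprodI M) • w) = 1 := by
          apply h2 l k hkl.symm
          rw [h1]
          intro h
          exact hyw (inv_mul_eq_one.mp h).symm
        exact hx (he.symm.trans this)
    have e2 : hd k ((of x⁻¹ : CoprodI M) • (of y⁻¹ : CoprodI M) • w) ≠ 1 := by
      rw [h1]
      intro h
      exact e1 (inv_mul_eq_one.mp h).symm
    have e3 := h2 k l hkl _ e2
    have e4 : hd l ((of y : CoprodI M) • (of x⁻¹ : CoprodI M) • (of y⁻¹ : CoprodI M) • w) = y := by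
      rw [h1, e3, mul_one]
    have e5 := h2 l k hkl.symm _ (e4.trans_ne hy)
    refine ⟨?_, ?_⟩
    · simp only [mul_smul]
      rw [h1, e5, mul_one]
    · simp only [mul_smul]
      rw [map_inv of x, inv_smul_smul, ← map_inv of x]
      exact e4
  let z : ULift.{u} (Fin 2) → M i := fun t => if t.down = 0 then a else b
  have hz : ∀ t, z t ≠ 1 := by
    intro t; simp only [z]; split_ifs <;> assumption
  have hzz : ∀ s t, s ≠ t → z s ≠ z t := by
    rintro ⟨s⟩ ⟨t⟩ hst
    fin_cases s <;> fin_cases t <;> simp_all [z, hab.symm]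
  have hfun : (fun t : ULift.{u} (Fin 2) =>
      if t.down = 0 then (of a * of c * of a⁻¹ * of c⁻¹ : CoprodI M)
      else of b * of c * of b⁻¹ * of c⁻¹) =
      fun t => of (z t) * of c * of (z t)⁻¹ * of c⁻¹ := by
    funext t; simp only [z]; split_ifs <;> rfl
  rw [hfun]
  have hXY : ∀ s t, Disjoint (P i j (z s) c) (P j i c (z t)) := by
    intro s t
    rw [Set.disjoint_left]
    rintro w ⟨hw, -⟩ ⟨hw', -⟩
    exact hc (hw'.symm.trans (h2 i j hij w (hw.trans_ne (hz s))))
  have hne : ∀ t, (P i j (z t) c).Nonempty := by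
    intro t
    by_cases h : (Word.empty : Word M) ∈ P j i c (z t)
    · refine ⟨_, key i j hij (z t) c (hz t) hc
        ((of c⁻¹ : CoprodI M) • (Word.empty : Word M)) ?_⟩
      rintro ⟨h', -⟩
      rw [h1, h.1] at h'
      exact hc (h'.symm.trans (inv_mul_cancel c))
    · exact ⟨_, key i j hij (z t) c (hz t) hc _ h⟩
  refine FreeGroup.injective_lift_of_ping_pong _ (α := Word M) (fun t => P i j (z t) c)
    (fun t => P j i c (z t)) hne ?_ ?_ hXY ?_ ?_
  · intro s t hst
    refine Set.disjoint_left.mpr ?_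
    rintro w ⟨hw, -⟩ ⟨hw', -⟩
    exact hzz s t hst (hw.symm.trans hw')
  · intro s t hst
    refine Set.disjoint_left.mpr ?_
    rintro w ⟨-, hw⟩ ⟨-, hw'⟩
    exact hzz s t hst (hw.symm.trans hw')
  · rintro t _ ⟨w, hw, rfl⟩
    exact key i j hij _ _ (hz t) hc w hw
  · rintro t _ ⟨w, hw, rfl⟩
    have := key j i hij.symm _ _ hc (hz t) w hw
    convert this using 2
    simp [mul_assoc]

open Monoid in
theorem ff_half0.{u, v, w} {G₁ : Type u} {G₂ : Type v} [Group G₁] [Group G₂]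
    {M : Bool → Type w} [∀ t, Group (M t)] (e1 : G₁ →* M false) (e2 : G₂ →* M true)
    (i1 : Function.Injective e1) (i2 : Function.Injective e2) {a b : G₁} {c : G₂}
    (ha : a ≠ 1) (hb : b ≠ 1) (hab : a ≠ b) (hc : c ≠ 1) :
    ∃ f : FreeGroup (Fin 2) →* Monoid.Coprod G₁ G₂, Function.Injective f := by
  let φ : Monoid.Coprod G₁ G₂ →* CoprodI M :=
    Coprod.lift ((CoprodI.of (M := M) (i := false)).comp e1)
      ((CoprodI.of (M := M) (i := true)).comp e2)
  have core := ff_core (M := M) (i := false) (j := true) (by decide)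
    (a := e1 a) (b := e1 b) (c := e2 c) ((map_ne_one_iff e1 i1).mpr ha)
    ((map_ne_one_iff e1 i1).mpr hb) (i1.ne hab) ((map_ne_one_iff e2 i2).mpr hc)
  let g : FreeGroup (Fin 2) →* Monoid.Coprod G₁ G₂ := FreeGroup.lift (fun t =>
      if t = 0 then (Coprod.inl a * Coprod.inr c * Coprod.inl a⁻¹ * Coprod.inr c⁻¹)
      else Coprod.inl b * Coprod.inr c * Coprod.inl b⁻¹ * Coprod.inr c⁻¹)
  let σ := FreeGroup.freeGroupCongr (Equiv.ulift.{w} (α := Fin 2)).symm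
  refine ⟨g, ?_⟩
  have hcomp := core.comp σ.injective
  refine Function.Injective.of_comp (f := φ) ?_
  have : φ.comp g = (FreeGroup.lift
      (fun t : ULift.{w} (Fin 2) =>
        if t.down = 0 then (CoprodI.of (e1 a) * CoprodI.of (e2 c) * CoprodI.of (e1 a)⁻¹ *
          CoprodI.of (e2 c)⁻¹ : CoprodI M)
        else CoprodI.of (e1 b) * CoprodI.of (e2 c) * CoprodI.of (e1 b)⁻¹ * CoprodI.of (e2 c)⁻¹)).comp σ.toMonoidHom := by
    refine FreeGroup.ext_hom _ _ (fun t => ?_)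
    fin_cases t <;> simp [φ, g, σ]
  rw [← MonoidHom.coe_comp, this]
  exact hcomp

def ffM.{u, v} (G₁ : Type u) (G₂ : Type v) : Bool → Type (max u v)
  | false => ULift.{v} G₁
  | true => ULift.{u} G₂

instance ffInst.{u, v} (G₁ : Type u) (G₂ : Type v) [Group G₁] [Group G₂] :
    ∀ t, Group (ffM G₁ G₂ t)
  | false => (inferInstance : Group (ULift.{v} G₁))
  | true => (inferInstance : Group (ULift.{u} G₂))

theorem ff_half.{u, v} {G₁ : Type u} {G₂ : Type v} [Group G₁] [Group G₂] {a b : G₁} {c : G₂}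
    (ha : a ≠ 1) (hb : b ≠ 1) (hab : a ≠ b) (hc : c ≠ 1) :
    ∃ f : FreeGroup (Fin 2) →* Monoid.Coprod G₁ G₂, Function.Injective f := by
  let e1 : G₁ →* ffM G₁ G₂ false :=
    { toFun := fun x => (ULift.up x : ULift.{v} G₁), map_one' := rfl, map_mul' := fun _ _ => rfl }
  let e2 : G₂ →* ffM G₁ G₂ true :=
    { toFun := fun x => (ULift.up x : ULift.{u} G₂), map_one' := rfl, map_mul' := fun _ _ => rfl }
  have i1 : Function.Injective e1 := fun x y h => congrArg (fun z : ULift.{v} G₁ => z.down) h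
  have i2 : Function.Injective e2 := fun x y h => congrArg (fun z : ULift.{u} G₂ => z.down) h
  exact ff_half0 e1 e2 i1 i2 ha hb hab hc

theorem ff_three {G : Type*} [Group G] [Nontrivial G] (h : Nat.card G ≠ 2) :
    ∃ a b : G, a ≠ 1 ∧ b ≠ 1 ∧ a ≠ b := by
  obtain ⟨a, ha⟩ := exists_ne (1 : G)
  by_contra! hcon
  apply h
  rw [Nat.card_eq_two_iff]
  refine ⟨1, a, ha.symm, ?_⟩
  ext x
  simp only [Set.mem_insert_iff, Set.mem_singleton_iff, Set.mem_univ, iff_true]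
  by_cases hx : x = 1
  · exact Or.inl hx
  · exact Or.inr (hcon a x ha hx).symm

theorem free_group_embeds_into_free_product {G₁ G₂ : Type*} [Group G₁] [Group G₂]
    [Nontrivial G₁] [Nontrivial G₂] (h : ¬(Nat.card G₁ = 2 ∧ Nat.card G₂ = 2)) :
    ∃ f : FreeGroup (Fin 2) →* Monoid.Coprod G₁ G₂, Function.Injective f := by
  by_cases h1 : Nat.card G₁ = 2
  · obtain ⟨a, b, ha, hb, hab⟩ := ff_three (G := G₂) (fun h2 => h ⟨h1, h2⟩)
    obtain ⟨c, hc⟩ := exists_ne (1 : G₁)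
    obtain ⟨f, hf⟩ := ff_half ha hb hab hc
    refine ⟨(Monoid.Coprod.swap G₂ G₁).comp f, ?_⟩
    exact Monoid.Coprod.swap_injective.comp hf
  · obtain ⟨a, b, ha, hb, hab⟩ := ff_three h1
    obtain ⟨c, hc⟩ := exists_ne (1 : G₂)
    exact ff_half ha hb hab hc
end

section
/- Let G₁ and G₂ be groups and let n ≥ 2. If (F₂)^n embeds into the free product G₁ ∗ G₂, then (F₂)^n embeds into G₁ or (F₂)^n embeds into G₂. Consequently, for nontrivial G₁, G₂ not both of order two, ν(G₁ ∗ G₂) = max{1, ν(G₁), ν(G₂)}. -/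
set_option linter.unusedSectionVars false

namespace FreeTorusAux

open Monoid Monoid.CoprodI Monoid.CoprodI.Word

theorem list_comm {α : Type*} (x u v : List α) (hx : x ≠ [])
    (hu : u ++ x = x ++ u) (hv : v ++ x = x ++ v) : u ++ v = v ++ u := by
  have key : ∀ a : FreeMonoid α, Commute a (FreeMonoid.ofList x) →
      ∀ k, a.toList.length ≤ k →
        a.toList = ((FreeMonoid.ofList x) ^ k).toList.take a.toList.length := by
    intro a ha k hk
    have h1 := (ha.pow_right k).eq
    have h2 := congrArg FreeMonoid.toList h1
    rw [FreeMonoid.toList_mul, FreeMonoid.toList_mul] at h2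
    have hl : ∀ k : ℕ, k ≤ ((FreeMonoid.ofList x) ^ k).toList.length := by
      intro k
      induction k with
      | zero => simp
      | succ k ih =>
        rw [pow_succ, FreeMonoid.toList_mul, List.length_append]
        have : 0 < x.length := List.length_pos_iff.2 hx
        simp only [FreeMonoid.toList_ofList]
        omega
    have h3 := congrArg (List.take a.toList.length) h2
    rw [List.take_left, List.take_append_of_le_length (hk.trans (hl k))] at h3
    exact h3
  have cu : Commute (FreeMonoid.ofList u) (FreeMonoid.ofList x) := hu
  have cv : Commute (FreeMonoid.ofList v) (FreeMonoid.ofList x) := hv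
  have h1 := key _ (cu.mul_left cv) (u.length + v.length) (by simp)
  have h2 := key _ (cv.mul_left cu) (u.length + v.length) (by simp [add_comm])
  simp only [FreeMonoid.toList_mul, FreeMonoid.toList_ofList, List.length_append] at h1 h2
  rw [h1, h2, add_comm]

section
variable {ι : Type*} {M : ι → Type*} [∀ i, Group (M i)] [DecidableEq ι] [∀ i, DecidableEq (M i)]

theorem smul_toList {i j} (w : NeWord M i j) (h : Word M) (hh : h.fstIdx ≠ some j) :
    (w.prod • h).toList = w.toList ++ h.toList := by
  induction w generalizing h with
  | singleton x hx =>
    rw [NeWord.prod_singleton, ← cons_eq_smul (h1 := hh) (h2 := hx)]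
    rfl
  | append w₁ hne w₂ ih1 ih2 =>
    rw [NeWord.append_prod, mul_smul, ih1, ih2 h hh]
    · simp
    · simp [fstIdx, ih2 h hh, hne.symm]

theorem smul_fstIdx {i j} (w : NeWord M i j) (h : Word M) (hh : h.fstIdx ≠ some j) :
    (w.prod • h).fstIdx = some i := by
  simp [fstIdx, smul_toList w h hh]

theorem empty_fstIdx_ne (i : ι) : (empty : Word M).fstIdx ≠ some i := by
  simp [fstIdx, empty]

theorem exists_neWord (g : CoprodI M) (hg : g ≠ 1) :
    ∃ (i j : ι) (w : NeWord M i j), w.prod = g := by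
  obtain ⟨i, j, w, hw⟩ := NeWord.of_word (equiv g) (by
    intro h
    apply hg
    have := congrArg equiv.symm h
    rw [Equiv.symm_apply_apply] at this
    rw [this]; rfl)
  refine ⟨i, j, w, ?_⟩
  rw [NeWord.prod, hw]
  exact equiv.symm_apply_apply g

theorem exists_prod (h : Word M) : h = h.prod • (empty : Word M) :=
  (equiv.apply_symm_apply h).symm

theorem pow_not_fstIdx {i j} (x : NeWord M i j) (hij : i ≠ j) (h : Word M) :
    ∃ N, ((x.prod ^ N) • h).fstIdx ≠ some j := by
  by_contra! hc
  have : ∀ N, N ≤ h.toList.length ∧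
      h.toList.length = N * x.toList.length + ((x.prod ^ N) • h).toList.length := by
    intro N
    have hpos : 0 < x.toList.length := List.length_pos_iff.2 x.toList_ne_nil
    have hinv : x.inv.toList.length = x.toList.length := by
      clear hij hc hpos
      induction x with
      | singleton x hx => simp [NeWord.inv]
      | append w₁ hne w₂ ih1 ih2 => simp [NeWord.inv, ih1, ih2, add_comm]
    have : h.toList.length = N * x.toList.length + ((x.prod ^ N) • h).toList.length := by
      induction N with
      | zero => simp
      | succ N ih =>
        have h1 := smul_toList x.inv ((x.prod ^ (N + 1)) • h) (by rw [hc]; simpa using hij.symm)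
        rw [NeWord.inv_prod, ← mul_smul, pow_succ', inv_mul_cancel_left] at h1
        rw [h1, List.length_append, hinv, ← pow_succ'] at ih
        rw [ih]; ring
    refine ⟨?_, this⟩
    nlinarith
  have := (this (h.toList.length + 1)).1
  omega

theorem pow_fstIdx {i j} (x : NeWord M i j) (hij : i ≠ j) (h : Word M) :
    ∃ N, ∀ n ≥ N, ((x.prod ^ n) • h).fstIdx = some i := by
  obtain ⟨N, hN⟩ := pow_not_fstIdx x hij h
  refine ⟨N + 1, fun n hn => ?_⟩
  induction n, hn using Nat.le_induction with
  | base => rw [pow_succ', mul_smul, smul_fstIdx x _ hN]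
  | succ n hn ih =>
    rw [pow_succ', mul_smul, smul_fstIdx x]
    rw [ih]; simpa using hij

theorem neWord_prod_fstIdx {i j} (w : NeWord M i j) :
    (w.prod • (empty : Word M)).fstIdx = some i := smul_fstIdx w _ (empty_fstIdx_ne j)

theorem exists_pos {i j} (x : NeWord M i j) (hij : i ≠ j) (y : CoprodI M)
    (hy : Commute x.prod y) : ∃ (N : ℕ) (u : NeWord M i j), u.prod = x.prod ^ N * y := by
  obtain ⟨N₁, h1⟩ := pow_fstIdx x hij (y • empty)
  obtain ⟨N₂, h2⟩ := pow_fstIdx x.inv hij.symm (y⁻¹ • empty)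
  replace h1 := h1 (max N₁ N₂) (le_max_left _ _)
  replace h2 := h2 (max N₁ N₂) (le_max_right _ _)
  generalize max N₁ N₂ = N at h1 h2
  rw [← mul_smul] at h1 h2
  have e : x.inv.prod ^ N * y⁻¹ = (x.prod ^ N * y)⁻¹ := by
    rw [NeWord.inv_prod, (hy.pow_left N).eq, mul_inv_rev, inv_pow]
  rw [e] at h2
  obtain ⟨i', j', w, hw⟩ := exists_neWord (x.prod ^ N * y) (by
    intro h; rw [h, one_smul] at h1; exact empty_fstIdx_ne _ h1)
  rw [← hw, neWord_prod_fstIdx] at h1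
  rw [← hw, ← NeWord.inv_prod, neWord_prod_fstIdx] at h2
  obtain rfl := Option.some.inj h1
  obtain rfl := Option.some.inj h2
  exact ⟨N, w, hw⟩

theorem prod_toList {i j} (w : NeWord M i j) :
    (w.prod • (empty : Word M)).toList = w.toList := by
  rw [smul_toList _ _ (empty_fstIdx_ne j)]; simp [empty]

theorem prod_eq_of_toList {i j k l} (w : NeWord M i j) (w' : NeWord M k l)
    (h : w.toList = w'.toList) : w.prod = w'.prod := by
  simp [NeWord.prod, Word.prod, NeWord.toWord, h]

theorem centralizer_comm {i j} (x : NeWord M i j) (hij : i ≠ j) (y z : CoprodI M)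
    (hy : Commute x.prod y) (hz : Commute x.prod z) : Commute y z := by
  obtain ⟨N, u, hu⟩ := exists_pos x hij y hy
  obtain ⟨K, v, hv⟩ := exists_pos x hij z hz
  have aux : ∀ a b : NeWord M i j, Commute a.prod b.prod →
      a.toList ++ b.toList = b.toList ++ a.toList := by
    intro a b hab
    have h := hab.eq
    rw [← NeWord.append_prod (hne := hij.symm), ← NeWord.append_prod (hne := hij.symm)] at h
    have h2 := prod_toList (NeWord.append a hij.symm b)
    rw [h, prod_toList] at h2
    simpa using h2.symm
  have hux : Commute u.prod x.prod := by
    rw [hu]; exact ((Commute.refl _).pow_left N).mul_left hy.symm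
  have hvx : Commute v.prod x.prod := by
    rw [hv]; exact ((Commute.refl _).pow_left K).mul_left hz.symm
  have h := list_comm _ _ _ x.toList_ne_nil (aux u x hux) (aux v x hvx)
  have huv : Commute u.prod v.prod := by
    have := prod_eq_of_toList (NeWord.append u hij.symm v) (NeWord.append v hij.symm u)
      (by simpa using h)
    rw [NeWord.append_prod, NeWord.append_prod] at this
    exact this
  have ey : y = (x.prod ^ N)⁻¹ * u.prod := by rw [hu]; group
  have ez : z = (x.prod ^ K)⁻¹ * v.prod := by rw [hv]; group
  have hz' : Commute (x.prod ^ N)⁻¹ z := (hz.pow_left N).inv_left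
  have : Commute u.prod z := by
    rw [ez]
    exact ((hux.pow_right K).inv_right).mul_right huv
  rw [ey]
  exact hz'.mul_left this

theorem smul_of_fstIdx {i} (m : M i) (hm : m ≠ 1) (w : Word M) (h : w.fstIdx ≠ some i) :
    (of m • w).fstIdx = some i := by
  rw [← cons_eq_smul (h1 := h) (h2 := hm)]; simp

theorem length_smul_le {i} (m : M i) (w : Word M) (h : w.fstIdx = some i) :
    (of m • w).toList.length ≤ w.toList.length := by
  have hr : ∀ p : Pair M i, (rcons p).toList.length ≤ p.tail.toList.length + 1 := by
    intro p
    unfold rcons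
    split_ifs <;> simp
  have hw : w.toList.length = (equivPair i w).tail.toList.length + 1 := by
    have hh : (equivPair i w).head ≠ 1 := by
      intro h1
      have := equivPair_head_smul_equivPair_tail (i := i) w
      rw [h1, map_one, one_smul] at this
      exact (equivPair i w).fstIdx_ne (by rw [this, h])
    conv_lhs => rw [← equivPair_head_smul_equivPair_tail (i := i) w]
    rw [← cons_eq_smul (h1 := (equivPair i w).fstIdx_ne) (h2 := hh)]
    simp
  rw [hw, of_smul_def]
  exact hr _

theorem commute_of {i} (m : M i) (hm : m ≠ 1) (y : CoprodI M) (hy : Commute (of m) y) :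
    ∃ a : M i, y = of a := by
  set p := equivPair i (y • (empty : Word M)) with hp
  have e1 : of p.head • p.tail = y • (empty : Word M) := equivPair_head_smul_equivPair_tail _
  have e2 : y = of p.head * p.tail.prod := by
    have := congrArg Word.prod e1
    simpa using this.symm
  by_cases ht : p.tail.prod = 1
  · exact ⟨p.head, by rw [e2, ht, mul_one]⟩
  exfalso
  obtain ⟨k, l, t, hkl⟩ := exists_neWord _ ht
  have hk : k ≠ i := by
    have h1 := p.fstIdx_ne
    rw [exists_prod p.tail, ← hkl, neWord_prod_fstIdx] at h1
    simpa using h1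
  set m' := p.head⁻¹ * m * p.head with hm'
  have hm1 : m' ≠ 1 := by
    intro h
    apply hm
    have : m = p.head * m' * p.head⁻¹ := by rw [hm']; group
    rw [this, h]; group
  have hc : of m' * t.prod = t.prod * of m := by
    have h := hy.eq
    rw [e2, ← hkl] at h
    have h' : of m' * t.prod = (of p.head)⁻¹ * (of m * (of p.head * t.prod)) := by
      rw [hm']; simp only [map_mul, map_inv]; group
    rw [h', h]; group
  by_cases hl : l = i
  · subst hl
    have h1 := smul_toList t.inv (of m'⁻¹ • empty) (by
      rw [smul_of_fstIdx _ (inv_ne_one.2 hm1) _ (empty_fstIdx_ne l)]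
      simpa using Ne.symm hk)
    have h2 := length_smul_le m⁻¹ (t.inv.prod • empty) (neWord_prod_fstIdx _)
    have e : of m⁻¹ * t.inv.prod = t.inv.prod * of m'⁻¹ := by
      rw [NeWord.inv_prod, map_inv, map_inv, ← mul_inv_rev, ← hc, mul_inv_rev]
    rw [← mul_smul, e, mul_smul, h1, prod_toList,
      ← cons_eq_smul (h1 := empty_fstIdx_ne l) (h2 := inv_ne_one.2 hm1)] at h2
    simp at h2
  · have h1 : (t.prod • (of m • (empty : Word M))).fstIdx = some k := by
      apply smul_fstIdx
      rw [smul_of_fstIdx m hm _ (empty_fstIdx_ne i)]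
      simpa using Ne.symm hl
    rw [← mul_smul, ← hc, mul_smul, smul_of_fstIdx m' hm1] at h1
    · exact hk (Option.some.inj h1).symm
    · rw [neWord_prod_fstIdx]; simpa using hk

end

section
variable {ι : Type*} {M : ι → Type*} [∀ i, Group (M i)] [DecidableEq ι] [∀ i, DecidableEq (M i)]

theorem conj_aux (n : ℕ) : ∀ w : Word M, w.toList.length ≤ n → w.prod ≠ 1 →
    (∃ (c : CoprodI M) (i j : ι) (_ : i ≠ j) (x : NeWord M i j), w.prod = c * x.prod * c⁻¹) ∨
    (∃ (c : CoprodI M) (i : ι) (m : M i), m ≠ 1 ∧ w.prod = c * of m * c⁻¹) := by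
  induction n with
  | zero =>
    intro w hw h1
    exfalso
    apply h1
    have : w.toList = [] := List.length_eq_zero_iff.1 (Nat.le_zero.1 hw)
    simp [Word.prod, this]
  | succ n ih =>
    intro w hw h1
    obtain ⟨a, b, W, hW⟩ := NeWord.of_word w (by rintro rfl; exact h1 rfl)
    by_cases hab : a ≠ b
    · exact Or.inl ⟨1, a, b, hab, W, by rw [NeWord.prod, hW]; group⟩
    push Not at hab
    subst hab
    have hl : w.toList = W.toList := by rw [← hW]; rfl
    have hhead := W.toList_head?
    have hlast := W.toList_getLast?
    rw [← hl] at hhead hlast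
    generalize W.head = h at hhead
    generalize W.last = l at hlast
    clear hl hW W
    obtain ⟨L, hne, hch⟩ := w
    simp only at hhead hlast hw
    cases L with
    | nil => simp at hhead
    | cons s L =>
      obtain rfl : s = ⟨a, h⟩ := by simpa using hhead
      rcases List.eq_nil_or_concat L with rfl | ⟨mid, s, rfl⟩
      · exact Or.inr ⟨1, a, h, hne ⟨a, h⟩ (by simp), by simp [Word.prod]⟩
      · obtain rfl : s = ⟨a, l⟩ := by
          rw [List.concat_eq_append, ← List.cons_append, List.getLast?_append] at hlast
          simpa using hlast
        have hmidne : ∀ l ∈ mid, Sigma.snd l ≠ 1 := fun l hl => hne l (by simp [hl])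
        have hch2 : (mid ++ [(⟨a, l⟩ : Σ i, M i)]).IsChain fun l l' => Sigma.fst l ≠ Sigma.fst l' :=
          by
            rw [List.concat_eq_append] at hch
            exact hch.tail
        have hchm : mid.IsChain fun l l' : (Σ i, M i) => Sigma.fst l ≠ Sigma.fst l' :=
          (List.isChain_append.1 hch2).1
        let p : Word M := ⟨mid, hmidne, hchm⟩
        have hprod : ∀ (h1 h2), (Word.mk (⟨a, h⟩ :: mid.concat ⟨a, l⟩) h1 h2 : Word M).prod =
            of h * (p.prod * of (l * h)) * (of h)⁻¹ := by
          intro _ _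
          simp only [Word.prod, p, List.concat_eq_append, List.map_cons, List.map_append,
            List.prod_cons, List.prod_append, List.map_nil, List.prod_nil, map_mul, mul_one]
          group
        rw [hprod] at h1 ⊢
        by_cases hlh : l * h = 1
        · rw [hlh, map_one, mul_one] at h1 ⊢
          have hp1 : p.prod ≠ 1 := by
            intro e; apply h1; rw [e]; group
          have hlen : p.toList.length ≤ n := by simp at hw; simp [p]; omega
          rcases ih p hlen hp1 with ⟨c, i, j, hij, x, hx⟩ | ⟨c, i, m, hm, hx⟩
          · exact Or.inl ⟨of h * c, i, j, hij, x, by rw [hx]; group⟩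
          · exact Or.inr ⟨of h * c, i, m, hm, by rw [hx]; group⟩
        · left
          cases mid with
          | nil => simp at hch
          | cons s mid =>
            have hsa : a ≠ s.1 := by
              simp only [List.concat_eq_append, List.cons_append, List.isChain_cons_cons] at hch
              exact hch.1
            let q : Word M := ⟨(s :: mid) ++ [⟨a, l * h⟩], by
              intro x hx
              rcases List.mem_append.1 hx with hx | hx
              · exact hmidne x hx
              · simp only [List.mem_singleton] at hx
                subst hx; exact hlh, by
              rw [List.isChain_append] at hch2 ⊢
              refine ⟨hch2.1, by simp, ?_⟩
              intro x hx y hy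
              have := hch2.2.2 x hx ⟨a, l⟩ (by simp)
              simp at hy
              subst hy
              exact this⟩
            obtain ⟨i, j, x, hx⟩ := NeWord.of_word q (by
              intro h; have := congrArg Word.toList h; simp [q, Word.empty] at this)
            have hxl : x.toList = q.toList := by rw [← hx]; rfl
            have hi := x.toList_head?
            have hj := x.toList_getLast?
            rw [hxl] at hi hj
            have hi' : s.1 = i := by
              have := congrArg (Option.map Sigma.fst) hi
              simpa [q] using this
            have hj' : a = j := by
              have := congrArg (Option.map Sigma.fst) hj
              rw [List.getLast?_append] at this
              simpa using this
            refine ⟨of h, i, j, ?_, x, ?_⟩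
            · rw [← hi', ← hj']; exact hsa.symm
            · rw [NeWord.prod, hx]
              congr 2
              simp [Word.prod, p, q, mul_assoc]

theorem conj_cases (g : CoprodI M) (hg : g ≠ 1) :
    (∃ (c : CoprodI M) (i j : ι) (_ : i ≠ j) (x : NeWord M i j), g = c * x.prod * c⁻¹) ∨
    (∃ (c : CoprodI M) (i : ι) (m : M i), m ≠ 1 ∧ g = c * of m * c⁻¹) := by
  have e : (equiv g).prod = g := equiv.symm_apply_apply g
  have := conj_aux _ (equiv g) le_rfl (by rw [e]; exact hg)
  rwa [e] at this

/-- projection to a factor -/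
def pr (k : ι) : CoprodI M →* M k := CoprodI.lift (Pi.mulSingle k (MonoidHom.id (M k)))

theorem pr_same {k : ι} (m : M k) : pr k (of m) = m := by simp [pr]

theorem pr_ne {k i : ι} (h : i ≠ k) (m : M i) : pr k (of m) = 1 := by
  simp [pr, Pi.mulSingle_eq_of_ne h]

theorem commute_conj {G : Type*} [Group G] {c x y : G} (h : Commute (c * x * c⁻¹) y) :
    Commute x (c⁻¹ * y * c) := by
  have := h.eq
  change x * (c⁻¹ * y * c) = c⁻¹ * y * c * x
  calc x * (c⁻¹ * y * c) = c⁻¹ * ((c * x * c⁻¹) * y) * c := by group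
    _ = _ := by rw [this]; group

theorem type_lemma (x y z : CoprodI M) (hx : x ≠ 1) (hy : Commute x y) (hz : Commute x z)
    (hyz : ¬ Commute y z) : ∃ k : ι, ∀ v, Commute x v → v ≠ 1 →
      pr k v ≠ 1 ∧ ∀ l, l ≠ k → pr l v = 1 := by
  rcases conj_cases x hx with ⟨c, i, j, hij, w, rfl⟩ | ⟨c, i, m, hm, rfl⟩
  · exfalso
    have h := (centralizer_comm w hij _ _ (commute_conj hy) (commute_conj hz)).eq
    apply hyz
    change y * z = z * y
    calc y * z = c * ((c⁻¹ * y * c) * (c⁻¹ * z * c)) * c⁻¹ := by group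
      _ = _ := by rw [h]; group
  · refine ⟨i, fun v hv hv1 => ?_⟩
    obtain ⟨a, ha⟩ := commute_of m hm _ (commute_conj hv)
    have e : v = c * of a * c⁻¹ := by rw [← ha]; group
    constructor
    · intro h
      apply hv1
      rw [e, map_mul, map_mul, map_inv, pr_same] at h
      have : a = 1 := by simpa using h
      rw [e, this]; simp
    · intro l hl
      rw [e, map_mul, map_mul, map_inv, pr_ne hl.symm]; simp

end

theorem freeGroup_center (y : FreeGroup (Fin 2)) (hy : y ≠ 1) : ∃ c, ¬ Commute y c := by
  classical
  by_contra! hc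
  let e := freeGroupEquivCoprodI (ι := Fin 2)
  have h : ∀ i : Fin 2, ∃ a : FreeGroup Unit, e y = of (i := i) a := by
    intro i
    apply commute_of (M := fun _ : Fin 2 => FreeGroup Unit) (i := i) (FreeGroup.of ())
      (FreeGroup.of_ne_one _)
    have := (hc (e.symm (of (i := i) (FreeGroup.of ())))).map e
    simpa using this.symm
  obtain ⟨a, ha⟩ := h 0
  obtain ⟨b, hb⟩ := h 1
  have h0 := congrArg (pr (M := fun _ : Fin 2 => FreeGroup Unit) 0) (ha.symm.trans hb)
  rw [pr_same, pr_ne (by decide)] at h0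
  rw [h0, map_one] at ha
  exact hy (by simpa using ha)

theorem freeGroup_noncomm : ¬ Commute (FreeGroup.of (0 : Fin 2)) (FreeGroup.of 1) := by
  intro h
  have := congrArg FreeGroup.toWord h.eq
  revert this
  decide

theorem main_coprodI {ι : Type*} {M : ι → Type*} [∀ i, Group (M i)] [DecidableEq ι]
    (n : ℕ) (hn : 2 ≤ n) (f : (Fin n → FreeGroup (Fin 2)) →* CoprodI M)
    (hf : Function.Injective f) : ∃ k, Function.Injective ((pr k).comp f) := by
  classical
  let s : Fin n → FreeGroup (Fin 2) → CoprodI M := fun i a => f (Pi.mulSingle i a)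
  have sc : ∀ i j a b, i ≠ j → Commute (s i a) (s j b) := fun i j a b hij =>
    (Pi.mulSingle_commute hij a b).map f
  have s1 : ∀ i a, a ≠ 1 → s i a ≠ 1 := by
    intro i a ha h
    apply ha
    have : Pi.mulSingle i a = (1 : Fin n → FreeGroup (Fin 2)) := hf (by rw [map_one]; exact h)
    simpa using this
  have snc : ∀ i a b, ¬ Commute a b → ¬ Commute (s i a) (s i b) := by
    intro i a b hab h
    apply hab
    have h2 : Pi.mulSingle i a * Pi.mulSingle i b = Pi.mulSingle i b * Pi.mulSingle i a :=
      hf (by rw [map_mul, map_mul]; exact h.eq)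
    have := congrFun h2 i
    simp only [Pi.mul_apply, Pi.mulSingle_eq_same] at this
    exact this
  let i0 : Fin n := ⟨0, by omega⟩
  let i1 : Fin n := ⟨1, by omega⟩
  have h01 : i0 ≠ i1 := by simp [i0, i1]
  let g := FreeGroup.of (0 : Fin 2)
  have hg : g ≠ 1 := FreeGroup.of_ne_one _
  obtain ⟨k, hk⟩ := type_lemma (s i0 g) _ _ (s1 _ _ hg) (sc i0 i1 _ _ h01) (sc i0 i1 _ _ h01)
    (snc i1 _ _ freeGroup_noncomm)
  obtain ⟨k', hk'⟩ := type_lemma (s i1 g) _ _ (s1 _ _ hg) (sc i1 i0 _ _ h01.symm)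
    (sc i1 i0 _ _ h01.symm) (snc i0 _ _ freeGroup_noncomm)
  have hkk : k = k' := by
    by_contra hne
    exact (hk (s i1 g) (sc _ _ _ _ h01) (s1 _ _ hg)).1
      ((hk' (s i1 g) (Commute.refl _) (s1 _ _ hg)).2 k hne)
  subst hkk
  have hs : ∀ i a, a ≠ 1 → pr k (s i a) ≠ 1 := by
    intro i a ha
    by_cases hi : i0 = i
    · exact (hk' _ (sc _ _ _ _ (by rw [← hi]; exact h01.symm)) (s1 _ _ ha)).1
    · exact (hk _ (sc _ _ _ _ hi) (s1 _ _ ha)).1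
  refine ⟨k, (injective_iff_map_eq_one _).2 fun x hx => ?_⟩
  by_contra hx1
  obtain ⟨i, hi⟩ := Function.ne_iff.1 hx1
  obtain ⟨c, hc⟩ := freeGroup_center (x i) hi
  have hcomm : x * Pi.mulSingle i c * x⁻¹ * (Pi.mulSingle i c)⁻¹ =
      Pi.mulSingle i (x i * c * (x i)⁻¹ * c⁻¹) := by
    funext j
    by_cases hj : j = i
    · subst hj; simp
    · simp [hj]
  refine hs i (x i * c * (x i)⁻¹ * c⁻¹) ?_ ?_
  · intro h
    apply hc
    have := mul_inv_eq_one.1 h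
    exact mul_inv_eq_iff_eq_mul.1 this
  · change ((pr k).comp f) _ = 1
    rw [← hcomm, map_mul, map_mul, map_mul, map_inv, map_inv, hx]
    simp

universe u v

section
variable {ι : Type*} {M : ι → Type*} [∀ i, Group (M i)] [DecidableEq ι] [∀ i, DecidableEq (M i)]

/-- first letter in a given factor -/
def hd (i : ι) (w : Word M) : M i := (equivPair i w).head

theorem hd_smul {i : ι} (m : M i) (w : Word M) : hd i (of m • w) = m * hd i w := by
  simp [hd, equivPair_smul_same]

theorem hd_other {i j : ι} (hij : i ≠ j) (w : Word M) (h : hd i w ≠ 1) : hd j w = 1 := by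
  have hw : w.fstIdx = some i := by
    by_contra hc
    apply h
    rw [hd, equivPair_eq_of_fstIdx_ne hc]
  rw [hd, equivPair_eq_of_fstIdx_ne]
  rw [hw]; simpa using hij

theorem hd_empty (i : ι) : hd i (empty : Word M) = 1 := by
  rw [hd, equivPair_eq_of_fstIdx_ne (empty_fstIdx_ne i)]

open scoped Pointwise in
theorem free_embeds_aux {ι : Type u} {M : ι → Type v} [∀ i, Group (M i)] [DecidableEq ι]
    [∀ i, DecidableEq (M i)] {I : Type (max u v)} [Nontrivial I] {i j : ι} (hij : i ≠ j) (a : I → M i) (ha : ∀ t, a t ≠ 1)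
    (hinj : Function.Injective a) (c : M j) (hc : c ≠ 1) :
    ∃ f : FreeGroup I →* CoprodI M, Function.Injective f := by
  let u : I → CoprodI M := fun t => of (a t) * of c * of (a t)⁻¹ * of c⁻¹
  let X : I → Set (Word M) := fun t => {w | hd i w = a t}
  let Y : I → Set (Word M) := fun t => {w | hd j w = c ∧ hd i (of c⁻¹ • w) = a t}
  refine ⟨FreeGroup.lift u, FreeGroup.injective_lift_of_ping_pong u X Y ?_ ?_ ?_ ?_ ?_ ?_⟩
  · intro t
    refine ⟨of (a t) • empty, ?_⟩
    simp [X, hd_smul, hd_empty]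
  · intro s t hst
    refine Set.disjoint_left.2 fun w h1 h2 => hst (hinj ?_)
    exact Eq.trans (Eq.symm h1) h2
  · intro s t hst
    refine Set.disjoint_left.2 fun w h1 h2 => hst (hinj ?_)
    exact Eq.trans (Eq.symm h1.2) h2.2
  · intro s t
    refine Set.disjoint_left.2 fun w h1 h2 => ?_
    have h1 : hd i w = a s := h1
    have := hd_other hij w (by rw [h1]; exact ha s)
    exact hc (h2.1.symm.trans this)
  · rintro t _ ⟨w, hw, rfl⟩
    have h1 : hd i (of c⁻¹ • w) ≠ a t := by
      by_cases h : hd j w = c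
      · exact fun h' => hw ⟨h, h'⟩
      · have := hd_other hij.symm (of c⁻¹ • w) (by
          rw [hd_smul]; intro h'; exact h (inv_mul_eq_one.1 h').symm)
        rw [this]; exact (ha t).symm
    have h2 : hd j (of (a t)⁻¹ • of c⁻¹ • w) = 1 := hd_other hij _ (by
      rw [hd_smul]; intro h'; exact h1 (inv_mul_eq_one.1 h').symm)
    have h3 : hd i (of c • of (a t)⁻¹ • of c⁻¹ • w) = 1 := hd_other hij.symm _ (by
      rw [hd_smul, h2, mul_one]; exact hc)
    change hd i (u t • w) = a t
    simp only [u, mul_smul]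
    rw [hd_smul, h3, mul_one]
  · rintro t _ ⟨w, hw, rfl⟩
    have h0 : hd i w ≠ a t := hw
    have h1 : hd j (of (a t)⁻¹ • w) = 1 := hd_other hij _ (by
      rw [hd_smul]; intro h'; exact h0 (inv_mul_eq_one.1 h').symm)
    have h2 : hd i (of c⁻¹ • of (a t)⁻¹ • w) = 1 := hd_other hij.symm _ (by
      rw [hd_smul, h1, mul_one]; exact inv_ne_one.2 hc)
    have h3 : hd i (of (a t) • of c⁻¹ • of (a t)⁻¹ • w) = a t := by
      rw [hd_smul, h2, mul_one]
    have h4 : hd j (of (a t) • of c⁻¹ • of (a t)⁻¹ • w) = 1 := hd_other hij _ (by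
      rw [h3]; exact ha t)
    have e : (u⁻¹ t) • w = of c • of (a t) • of c⁻¹ • of (a t)⁻¹ • w := by
      simp only [← mul_smul, u, Pi.inv_apply]
      congr 1
      simp only [map_inv]
      group
    change (u⁻¹ t) • w ∈ Y t
    rw [e]
    refine ⟨?_, ?_⟩
    · rw [hd_smul, h4, mul_one]
    · rw [← mul_smul (of c⁻¹), ← map_mul, inv_mul_cancel, map_one, one_smul, h3]

end

theorem free_embeds {ι : Type u} {M : ι → Type v} [∀ i, Group (M i)] [DecidableEq ι]
    [∀ i, DecidableEq (M i)] {i j : ι} (hij : i ≠ j) (a : Fin 2 → M i) (ha : ∀ t, a t ≠ 1)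
    (hinj : Function.Injective a) (c : M j) (hc : c ≠ 1) :
    ∃ f : FreeGroup (Fin 2) →* CoprodI M, Function.Injective f := by
  obtain ⟨f, hf⟩ := free_embeds_aux (I := ULift.{max u v} (Fin 2)) hij (fun t => a t.down)
    (fun t => ha _) (hinj.comp ULift.down_injective) c hc
  exact ⟨f.comp (FreeGroup.freeGroupCongr Equiv.ulift.symm).toMonoidHom,
    hf.comp (MulEquiv.injective _)⟩

theorem exists_two {G : Type*} [Group G] [Nontrivial G] (h : Nat.card G ≠ 2) :
    ∃ a : Fin 2 → G, (∀ t, a t ≠ 1) ∧ Function.Injective a := by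
  obtain ⟨a, ha⟩ := exists_ne (1 : G)
  by_cases hb : ∃ b : G, b ≠ 1 ∧ b ≠ a
  · obtain ⟨b, hb1, hba⟩ := hb
    refine ⟨![a, b], ?_, ?_⟩
    · intro t; fin_cases t <;> simp [ha, hb1]
    · intro s t hst
      fin_cases s <;> fin_cases t <;> simp_all [eq_comm]
  · exfalso
    push Not at hb
    apply h
    rw [Nat.card_eq_two_iff]
    refine ⟨1, a, ha.symm, ?_⟩
    ext b
    by_cases h1 : b = 1 <;> simp_all


/-- the two groups as a family over `Bool` -/
def Fam (G₁ : Type u) (G₂ : Type v) : Bool → Type (max u v)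
  | false => ULift.{v} G₁
  | true => ULift.{u} G₂

instance famGroup (G₁ : Type u) (G₂ : Type v) [Group G₁] [Group G₂] : ∀ b, Group (Fam G₁ G₂ b)
  | false => inferInstanceAs (Group (ULift.{v} G₁))
  | true => inferInstanceAs (Group (ULift.{u} G₂))

/-- first factor -/
def famL (G₁ : Type u) (G₂ : Type v) [Group G₁] [Group G₂] : Fam G₁ G₂ false ≃* G₁ :=
  (MulEquiv.ulift : ULift.{v} G₁ ≃* G₁)

/-- second factor -/
def famR (G₁ : Type u) (G₂ : Type v) [Group G₁] [Group G₂] : Fam G₁ G₂ true ≃* G₂ :=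
  (MulEquiv.ulift : ULift.{u} G₂ ≃* G₂)

/-- binary coproduct into indexed coproduct -/
def toI (G₁ : Type u) (G₂ : Type v) [Group G₁] [Group G₂] :
    Monoid.Coprod G₁ G₂ →* CoprodI (Fam G₁ G₂) :=
  Monoid.Coprod.lift ((of (i := false)).comp (famL G₁ G₂).symm.toMonoidHom)
    ((of (i := true)).comp (famR G₁ G₂).symm.toMonoidHom)

/-- and back -/
def fromI (G₁ : Type u) (G₂ : Type v) [Group G₁] [Group G₂] :
    CoprodI (Fam G₁ G₂) →* Monoid.Coprod G₁ G₂ :=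
  CoprodI.lift fun b => match b with
    | false => Monoid.Coprod.inl.comp (famL G₁ G₂).toMonoidHom
    | true => Monoid.Coprod.inr.comp (famR G₁ G₂).toMonoidHom

theorem from_to (G₁ : Type u) (G₂ : Type v) [Group G₁] [Group G₂] :
    (fromI G₁ G₂).comp (toI G₁ G₂) = MonoidHom.id _ := by
  apply Monoid.Coprod.hom_ext
  · ext x; simp [fromI, toI]
  · ext x; simp [fromI, toI]

theorem to_from (G₁ : Type u) (G₂ : Type v) [Group G₁] [Group G₂] :
    (toI G₁ G₂).comp (fromI G₁ G₂) = MonoidHom.id _ := by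
  apply CoprodI.ext_hom
  rintro (_ | _)
  · ext x; simp [fromI, toI]
  · ext x; simp [fromI, toI]

/-- equivalence -/
def eqI (G₁ : Type u) (G₂ : Type v) [Group G₁] [Group G₂] :
    Monoid.Coprod G₁ G₂ ≃* CoprodI (Fam G₁ G₂) :=
  MonoidHom.toMulEquiv _ _ (from_to G₁ G₂) (to_from G₁ G₂)

theorem part_one (G₁ : Type u) (G₂ : Type v) [Group G₁] [Group G₂] (n : ℕ) (hn : 2 ≤ n)
    (h : FreeTorusEmbeds n (Monoid.Coprod G₁ G₂)) :
    FreeTorusEmbeds n G₁ ∨ FreeTorusEmbeds n G₂ := by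
  obtain ⟨f, hf⟩ := h
  obtain ⟨k, hk⟩ := main_coprodI n hn ((eqI G₁ G₂).toMonoidHom.comp f)
    ((eqI G₁ G₂).injective.comp hf)
  cases k with
  | false => exact Or.inl ⟨(famL G₁ G₂).toMonoidHom.comp ((pr false).comp ((eqI G₁ G₂).toMonoidHom.comp f)),
      (famL G₁ G₂).injective.comp hk⟩
  | true => exact Or.inr ⟨(famR G₁ G₂).toMonoidHom.comp ((pr true).comp ((eqI G₁ G₂).toMonoidHom.comp f)),
      (famR G₁ G₂).injective.comp hk⟩

theorem embeds_one (G₁ : Type u) (G₂ : Type v) [Group G₁] [Group G₂] [Nontrivial G₁]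
    [Nontrivial G₂] (h : ¬(Nat.card G₁ = 2 ∧ Nat.card G₂ = 2)) :
    FreeTorusEmbeds 1 (Monoid.Coprod G₁ G₂) := by
  classical
  have : ∃ f : FreeGroup (Fin 2) →* CoprodI (Fam G₁ G₂), Function.Injective f := by
    by_cases h1 : Nat.card G₁ = 2
    · obtain ⟨a, ha, hi⟩ := exists_two (fun h2 => h ⟨h1, h2⟩)
      obtain ⟨c, hc⟩ := exists_ne (1 : G₁)
      exact free_embeds (M := Fam G₁ G₂) (i := true) (j := false) (by decide)
        (fun t => (famR G₁ G₂).symm (a t)) (fun t => by simpa using ha t)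
        ((famR G₁ G₂).symm.injective.comp hi) ((famL G₁ G₂).symm c) (by simpa using hc)
    · obtain ⟨a, ha, hi⟩ := exists_two h1
      obtain ⟨c, hc⟩ := exists_ne (1 : G₂)
      exact free_embeds (M := Fam G₁ G₂) (i := false) (j := true) (by decide)
        (fun t => (famL G₁ G₂).symm (a t)) (fun t => by simpa using ha t)
        ((famL G₁ G₂).symm.injective.comp hi) ((famR G₁ G₂).symm c) (by simpa using hc)
  obtain ⟨f, hf⟩ := this
  refine ⟨((eqI G₁ G₂).symm.toMonoidHom.comp f).comp (Pi.evalMonoidHom _ 0), ?_⟩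
  refine ((eqI G₁ G₂).symm.injective.comp hf).comp ?_
  intro x y hxy
  funext t
  rw [Subsingleton.elim t 0]
  exact hxy

end FreeTorusAux

theorem free_torus_in_free_product {G₁ G₂ : Type*} [Group G₁] [Group G₂] :
    (∀ n : ℕ, 2 ≤ n → FreeTorusEmbeds n (Monoid.Coprod G₁ G₂) →
        FreeTorusEmbeds n G₁ ∨ FreeTorusEmbeds n G₂) ∧
    (Nontrivial G₁ → Nontrivial G₂ → ¬(Nat.card G₁ = 2 ∧ Nat.card G₂ = 2) →
      freeSubgroupRank (Monoid.Coprod G₁ G₂) =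
        max 1 (max (freeSubgroupRank G₁) (freeSubgroupRank G₂))) := by
  refine ⟨fun n hn h => FreeTorusAux.part_one G₁ G₂ n hn h, fun _ _ hcard => ?_⟩
  apply le_antisymm
  · apply sSup_le
    rintro _ ⟨n, rfl, hn⟩
    by_cases h2 : 2 ≤ n
    · rcases FreeTorusAux.part_one G₁ G₂ n h2 hn with h | h
      · exact le_max_of_le_right (le_max_of_le_left (le_sSup ⟨n, rfl, h⟩))
      · exact le_max_of_le_right (le_max_of_le_right (le_sSup ⟨n, rfl, h⟩))
    · apply le_max_of_le_left
      exact_mod_cast (by omega : n ≤ 1)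
  · refine max_le ?_ (max_le ?_ ?_)
    · exact le_sSup ⟨1, by simp, FreeTorusAux.embeds_one G₁ G₂ hcard⟩
    · apply sSup_le
      rintro _ ⟨n, rfl, f, hf⟩
      exact le_sSup ⟨n, rfl, Monoid.Coprod.inl.comp f, Monoid.Coprod.inl_injective.comp hf⟩
    · apply sSup_le
      rintro _ ⟨n, rfl, f, hf⟩
      exact le_sSup ⟨n, rfl, Monoid.Coprod.inr.comp f, Monoid.Coprod.inr_injective.comp hf⟩
end

section
/- Let p : G → Q be a surjective group homomorphism whose kernel is contained in the center of G (a central extension). For every n ∈ ℕ, if (F₂)^n embeds into Q, then (F₂)^n embeds into G. -/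
open scoped commutatorElement

theorem exists_free_in_commutator :
    ∃ ψ : FreeGroup (Fin 2) →* FreeGroup (Fin 2), Function.Injective ψ ∧
      ∀ x, ψ x ∈ commutator (FreeGroup (Fin 2)) := by
  let K := commutator (FreeGroup (Fin 2))
  let e := IsFreeGroup.mulEquiv K
  have hnt : Nontrivial (IsFreeGroup.Generators K) := by
    by_contra hn
    rw [not_nontrivial_iff_subsingleton] at hn
    have hcomm : ∀ x y : K, x * y = y * x := by
      intro x y
      obtain ⟨x, rfl⟩ := e.surjective x
      obtain ⟨y, rfl⟩ := e.surjective y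
      rw [← map_mul, ← map_mul]
      congr 1
      change Commute x y
      have key : ∀ (i : IsFreeGroup.Generators K) (z : FreeGroup (IsFreeGroup.Generators K)),
          Commute (FreeGroup.of i) z := by
        intro i z
        induction z using FreeGroup.induction_on with
        | C1 => exact Commute.one_right _
        | of j => rw [Subsingleton.elim i j]
        | inv_of j h => exact h.inv_right
        | mul a b ha hb => exact ha.mul_right hb
      induction x using FreeGroup.induction_on with
      | C1 => exact Commute.one_left _
      | of j => exact key j y
      | inv_of j h => exact h.inv_left
      | mul a b ha hb => exact ha.mul_left hb
    let a : FreeGroup (Fin 2) := FreeGroup.of 0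
    let b : FreeGroup (Fin 2) := FreeGroup.of 1
    have h := congrArg Subtype.val (hcomm
      ⟨⁅a, b⁆, Subgroup.commutator_mem_commutator (Subgroup.mem_top _) (Subgroup.mem_top _)⟩
      ⟨⁅a, b⁻¹⁆, Subgroup.commutator_mem_commutator (Subgroup.mem_top _) (Subgroup.mem_top _)⟩)
    have h2 : ⁅a, b⁆ * ⁅a, b⁻¹⁆ = ⁅a, b⁻¹⁆ * ⁅a, b⁆ := h
    have h3 := congrArg FreeGroup.toWord h2
    revert h3
    decide
  obtain ⟨s, t, hst⟩ := exists_pair_ne (IsFreeGroup.Generators K)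
  have hinj : Function.Injective (![s, t] : Fin 2 → IsFreeGroup.Generators K) := by
    intro i j
    fin_cases i <;> fin_cases j <;> simp [hst, hst.symm]
  refine ⟨K.subtype.comp (e.toMonoidHom.comp (FreeGroup.map ![s, t])), ?_, ?_⟩
  · exact Subtype.val_injective.comp (e.injective.comp (FreeGroup.map_injective hinj))
  · intro x
    exact (e (FreeGroup.map ![s, t] x)).2

theorem commute_of_central {A G : Type*} [Group A] [Group G] (φ : A →* G) (g : G)
    (h : ∀ u, ⁅φ u, g⁆ ∈ Subgroup.center G) (x : A) (hx : x ∈ commutator A) :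
    Commute (φ x) g := by
  let χ : A →* Subgroup.center G :=
    { toFun := fun u => ⟨⁅φ u, g⁆, h u⟩
      map_one' := by ext; simp
      map_mul' := by
        intro u v
        ext
        have hv := Subgroup.mem_center_iff.1 (h v) (φ u)
        have hu := Subgroup.mem_center_iff.1 (h u) ⁅φ v, g⁆
        change ⁅φ (u * v), g⁆ = ⁅φ u, g⁆ * ⁅φ v, g⁆
        rw [← hu]
        have : ⁅φ (u * v), g⁆ = (φ u * ⁅φ v, g⁆) * (g * (φ u)⁻¹ * g⁻¹) := by
          rw [map_mul]; simp only [commutatorElement_def]; group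
        rw [this, hv]
        simp only [commutatorElement_def]; group }
  let _ : CommGroup (Subgroup.center G) :=
    { (inferInstance : Group (Subgroup.center G)) with
      mul_comm := fun a b => Subtype.ext (Subgroup.mem_center_iff.1 b.2 a.1) }
  have := Abelianization.commutator_subset_ker (A := Subgroup.center G) χ hx
  rw [MonoidHom.mem_ker] at this
  exact commutatorElement_eq_one_iff_commute.1 (congrArg Subtype.val this)

theorem free_torus_lifts_through_central_extension {G Q : Type*} [Group G] [Group Q]
    (p : G →* Q) (hsurj : Function.Surjective p) (hcentral : p.ker ≤ Subgroup.center G) :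
    ∀ n : ℕ, FreeTorusEmbeds n Q → FreeTorusEmbeds n G := by
  rintro n ⟨f, hf⟩
  obtain ⟨ψ, hψ, hψc⟩ := exists_free_in_commutator
  choose s hs using hsurj
  let φ : Fin n → FreeGroup (Fin 2) →* G := fun i =>
    FreeGroup.lift (fun k => s (f (Pi.mulSingle i (FreeGroup.of k))))
  have hφ : ∀ i x, p (φ i x) = f (Pi.mulSingle i x) := by
    intro i x
    have : p.comp (φ i) = f.comp (MonoidHom.mulSingle (fun _ : Fin n => FreeGroup (Fin 2)) i) := by
      ext k
      simp [φ, hs]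
    exact DFunLike.congr_fun this x
  have hc : Pairwise fun i j => ∀ x y, Commute (((φ i).comp ψ) x) (((φ j).comp ψ) y) := by
    intro i j hij x y
    refine commute_of_central (φ i) _ (fun u => hcentral ?_) (ψ x) (hψc x)
    rw [MonoidHom.mem_ker, map_commutatorElement, commutatorElement_eq_one_iff_commute]
    simp only [MonoidHom.comp_apply, hφ]
    exact (Pi.mulSingle_commute hij _ _).map f
  let F := MonoidHom.noncommPiCoprod (fun i => (φ i).comp ψ) hc
  refine ⟨F, ?_⟩
  let Ψ : (Fin n → FreeGroup (Fin 2)) →* (Fin n → FreeGroup (Fin 2)) :=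
    MonoidHom.pi fun i => ψ.comp (Pi.evalMonoidHom _ i)
  have hΨ : Function.Injective Ψ := fun x y h => funext fun i => hψ (congrFun h i)
  have hcomp : p.comp F = f.comp Ψ := by
    apply MonoidHom.pi_ext
    intro i
    intro x
    simp only [MonoidHom.comp_apply, F, MonoidHom.mulSingle_apply,
      MonoidHom.noncommPiCoprod_mulSingle, hφ]
    congr 1
    ext k : 1
    by_cases hk : k = i
    · subst hk; simp [Ψ]
    · simp [Ψ, hk]
  have : Function.Injective (p ∘ F) := by
    rw [← MonoidHom.coe_comp, hcomp]
    exact hf.comp hΨ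
  exact this.of_comp
end

section
/- Let p : G → Q be a surjective group homomorphism whose kernel N contains no subgroup isomorphic to F₂. If H ≤ G is a subgroup isomorphic to F₂, then the restriction of p to H is injective. -/
lemma aux_dichotomy (L : Subgroup (FreeGroup (Fin 2))) :
    (∃ f : FreeGroup (Fin 2) →* L, Function.Injective f) ∨
      ∃ c ∈ L, ∀ x ∈ L, ∃ n : ℤ, x = c ^ n := by
  obtain ⟨X, ⟨b⟩⟩ := (inferInstance : IsFreeGroup L).nonempty_basis
  by_cases hX : ∃ x y : X, x ≠ y
  · obtain ⟨x, y, hxy⟩ := hX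
    left
    have hinj : Function.Injective (![x, y] : Fin 2 → X) := by
      intro i j
      fin_cases i <;> fin_cases j <;> simp [hxy, hxy.symm]
    exact ⟨b.repr.symm.toMonoidHom.comp (FreeGroup.map ![x, y]),
      b.repr.symm.injective.comp (FreeGroup.map_injective hinj)⟩
  · push Not at hX
    right
    have key : ∃ c : FreeGroup X, ∀ z, ∃ n : ℤ, z = c ^ n := by
      by_cases hne : Nonempty X
      · obtain ⟨x⟩ := hne
        refine ⟨FreeGroup.of x, fun z => ?_⟩
        have hz : z ∈ Subgroup.closure (Set.range (FreeGroup.of : X → FreeGroup X)) := by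
          rw [FreeGroup.closure_range_of]; trivial
        have hr : Set.range (FreeGroup.of : X → FreeGroup X) = {FreeGroup.of x} := by
          ext t
          constructor
          · rintro ⟨y, rfl⟩
            rw [hX y x]; rfl
          · rintro rfl
            exact ⟨x, rfl⟩
        rw [hr, Subgroup.mem_closure_singleton] at hz
        obtain ⟨n, hn⟩ := hz
        exact ⟨n, hn.symm⟩
      · rw [not_nonempty_iff] at hne
        exact ⟨1, fun z => ⟨0, Subsingleton.elim _ _⟩⟩
    obtain ⟨c, hc⟩ := key
    refine ⟨(b.repr.symm c : L), (b.repr.symm c).2, fun x hx => ?_⟩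
    obtain ⟨n, hn⟩ := hc (b.repr ⟨x, hx⟩)
    refine ⟨n, ?_⟩
    have : (⟨x, hx⟩ : L) = (b.repr.symm c) ^ n := by
      rw [← map_zpow, ← hn, MulEquiv.symm_apply_apply]
    simpa using congrArg Subtype.val this

lemma aux_noncomm :
    (FreeGroup.of 0 * FreeGroup.of 1 : FreeGroup (Fin 2)) ≠ FreeGroup.of 1 * FreeGroup.of 0 := by
  decide

lemma aux_comm (x y : FreeGroup (Fin 2)) (h : x * y = y * x) :
    ∃ (c : FreeGroup (Fin 2)) (m n : ℤ), x = c ^ m ∧ y = c ^ n := by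
  rcases aux_dichotomy (Subgroup.closure {x, y}) with ⟨f, hf⟩ | ⟨c, -, hc⟩
  · exfalso
    have hcomm : ∀ u ∈ ({x, y} : Set (FreeGroup (Fin 2))), ∀ v ∈ ({x, y} : Set (FreeGroup (Fin 2))),
        u * v = v * u := by
      rintro u (rfl | rfl) v (rfl | rfl) <;> first | rfl | exact h | exact h.symm
    let _ := Subgroup.closureCommGroupOfComm hcomm
    apply aux_noncomm
    apply hf
    rw [map_mul, map_mul]
    exact mul_comm (G := Subgroup.closure {x, y}) _ _
  · obtain ⟨m, hm⟩ := hc x (Subgroup.subset_closure (by simp))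
    obtain ⟨n, hn⟩ := hc y (Subgroup.subset_closure (by simp))
    exact ⟨c, m, n, hm, hn⟩

lemma aux_sq_comm (w g : FreeGroup (Fin 2)) (hw : w ≠ 1) (m n : ℤ)
    (h1 : g * w * g⁻¹ = w ^ n) (h2 : g⁻¹ * w * g = w ^ m) :
    (g ^ 2) * w = w * g ^ 2 := by
  have hinj : Function.Injective (fun k : ℤ => w ^ k) :=
    injective_zpow_iff_not_isOfFinOrder.2 (not_isOfFinOrder_of_isMulTorsionFree hw)
  have h3 : w ^ (n * m) = w ^ (1 : ℤ) := by
    have : (g * w * g⁻¹) ^ m = g * w ^ m * g⁻¹ := conj_zpow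
    rw [zpow_mul, ← h1, this, ← h2]
    group
  have h4 : n * m = 1 := hinj h3
  have h5 : n * n = 1 := by
    rcases Int.eq_one_or_neg_one_of_mul_eq_one h4 with h | h <;> simp [h]
  have h6 : g * (g * w * g⁻¹) * g⁻¹ = w := by
    have : (g * w * g⁻¹) ^ n = g * w ^ n * g⁻¹ := conj_zpow
    rw [h1, ← this, h1, ← zpow_mul, h5, zpow_one]
  calc g ^ 2 * w = (g * (g * w * g⁻¹) * g⁻¹) * g ^ 2 := by rw [pow_two]; group
    _ = _ := by rw [h6]

lemma aux_normal (K : Subgroup (FreeGroup (Fin 2))) [hK : K.Normal] (hne : K ≠ ⊥) :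
    ∃ f : FreeGroup (Fin 2) →* K, Function.Injective f := by
  rcases aux_dichotomy K with h | ⟨w, hwK, hw⟩
  · exact h
  exfalso
  have hw1 : w ≠ 1 := by
    rintro rfl
    apply hne
    rw [Subgroup.eq_bot_iff_forall]
    intro x hx
    obtain ⟨n, hn⟩ := hw x hx
    simpa using hn
  have hc : ∀ g : FreeGroup (Fin 2), (g ^ 2) * w = w * g ^ 2 := by
    intro g
    obtain ⟨n, hn⟩ := hw _ (hK.conj_mem w hwK g)
    obtain ⟨m, hm⟩ := hw _ (hK.conj_mem w hwK g⁻¹)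
    rw [inv_inv] at hm
    exact aux_sq_comm w g hw1 m n hn hm
  obtain ⟨c, i, j, h1, h2⟩ := aux_comm _ _ (hc (FreeGroup.of 0))
  obtain ⟨d, k, l, h3, h4⟩ := aux_comm _ _ (hc (FreeGroup.of 1))
  have hj : j ≠ 0 := by
    rintro rfl
    exact hw1 (by simpa using h2)
  have hk : k ≠ 0 := by
    rintro rfl
    rw [zpow_zero] at h3
    revert h3
    decide
  have e1 : (FreeGroup.of (0 : Fin 2) ^ 2) ^ (j * k) = w ^ (i * k) := by
    rw [h1, h2, ← zpow_mul, ← zpow_mul]; congr 1; ring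
  have e2 : (FreeGroup.of (1 : Fin 2) ^ 2) ^ (l * i) = w ^ (i * k) := by
    rw [h3, h4, ← zpow_mul, ← zpow_mul]; congr 1; ring
  have e3 := congrArg (FreeGroup.lift (![Multiplicative.ofAdd (1 : ℤ), 1])) (e1.trans e2.symm)
  simp only [map_zpow, map_pow, FreeGroup.lift_apply_of] at e3
  have e4 := congrArg Multiplicative.toAdd e3
  simp at e4
  tauto

theorem free_subgroup_injects_in_quotient {G Q : Type*} [Group G] [Group Q]
    (p : G →* Q) (hsurj : Function.Surjective p)
    (hker : ¬ ∃ N : Subgroup G, N ≤ p.ker ∧ Nonempty (N ≃* FreeGroup (Fin 2)))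
    (H : Subgroup G) (e : H ≃* FreeGroup (Fin 2)) :
    Function.Injective (p.comp H.subtype) := by
  by_contra hni
  let q : FreeGroup (Fin 2) →* G := H.subtype.comp e.symm.toMonoidHom
  have hq : Function.Injective q := H.subtype_injective.comp e.symm.injective
  have hne : (p.comp q).ker ≠ ⊥ := by
    intro hb
    rw [MonoidHom.ker_eq_bot_iff] at hb
    apply hni
    intro x y hxy
    apply e.injective
    apply hb
    simpa [q] using hxy
  obtain ⟨f, hf⟩ := aux_normal (p.comp q).ker hne
  let r : FreeGroup (Fin 2) →* G := q.comp ((p.comp q).ker.subtype.comp f)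
  have hr : Function.Injective r := hq.comp ((Subgroup.subtype_injective _).comp hf)
  refine hker ⟨r.range, ?_, ⟨(MonoidHom.ofInjective hr).symm⟩⟩
  rintro _ ⟨x, rfl⟩
  exact (f x).2
end

section
/- Let p : G → Q be a surjective group homomorphism whose kernel N contains no subgroup isomorphic to F₂. For every n ∈ ℕ, if (F₂)^n embeds into G, then (F₂)^n embeds into Q; in fact p maps any subgroup of G isomorphic to (F₂)^n isomorphically onto its image. In particular ν(G) ≤ ν(Q). -/
theorem ftaux_dichotomy (H : Subgroup (FreeGroup (Fin 2))) :
    (∃ f : FreeGroup (Fin 2) →* H, Function.Injective f) ∨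
    (∃ z ∈ H, ∀ h ∈ H, ∃ n : ℤ, z ^ n = h) := by
  have e : FreeGroup (IsFreeGroup.Generators H) ≃* H := IsFreeGroup.mulEquiv H
  generalize IsFreeGroup.Generators H = X at e
  by_cases hX : Subsingleton X
  · right
    have key : ∃ w : FreeGroup X, ∀ h, ∃ n : ℤ, w ^ n = h := by
      rcases isEmpty_or_nonempty X with hE | ⟨⟨x⟩⟩
      · exact ⟨1, fun h => ⟨0, Subsingleton.elim _ _⟩⟩
      · refine ⟨FreeGroup.of x, fun h => ?_⟩
        rw [← Subgroup.mem_closure_singleton]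
        have h1 : h ∈ Subgroup.closure (Set.range (FreeGroup.of : X → _)) := by
          rw [FreeGroup.closure_range_of]; trivial
        refine Subgroup.closure_mono ?_ h1
        rintro _ ⟨y, rfl⟩
        rw [Subsingleton.elim y x]; rfl
    obtain ⟨w, hw⟩ := key
    refine ⟨e w, (e w).2, fun h hh => ?_⟩
    obtain ⟨n, hn⟩ := hw (e.symm ⟨h, hh⟩)
    refine ⟨n, ?_⟩
    have := congrArg e hn
    rw [map_zpow, MulEquiv.apply_symm_apply] at this
    simpa using congrArg Subtype.val this
  · left
    rw [not_subsingleton_iff_nontrivial] at hX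
    obtain ⟨x, y, hxy⟩ := exists_pair_ne X
    refine ⟨e.toMonoidHom.comp (FreeGroup.map ![x, y]), ?_⟩
    refine e.injective.comp (FreeGroup.map_injective ?_)
    intro i j
    fin_cases i <;> fin_cases j <;> simp [hxy, hxy.symm]

/-- The exponent-sum homomorphism of one generator. -/
noncomputable def ftauxExp (i : Fin 2) : FreeGroup (Fin 2) →* Multiplicative ℤ :=
  FreeGroup.lift fun j => if j = i then Multiplicative.ofAdd 1 else 1

theorem ftaux_of_pow (i : Fin 2) (n : ℤ) (h : ftauxExp i (FreeGroup.of i ^ n) = 1) : n = 0 := by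
  rw [map_zpow] at h
  simp only [ftauxExp, FreeGroup.lift_apply_of, if_true] at h
  have := congrArg Multiplicative.toAdd h
  simpa using this

theorem ftaux_noncomm :
    FreeGroup.of (0 : Fin 2) * FreeGroup.of 1 ≠ FreeGroup.of 1 * FreeGroup.of 0 := by
  decide

theorem ftaux_commute (x y : FreeGroup (Fin 2)) (h : x * y = y * x) (hy : y ≠ 1) :
    ∃ m k : ℤ, m ≠ 0 ∧ x ^ m = y ^ k := by
  have hc : ∀ a ∈ Subgroup.closure {x, y}, ∀ b ∈ Subgroup.closure {x, y}, a * b = b * a := by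
    have := Subgroup.isMulCommutative_closure (k := {x, y}) (by
      intro a ha b hb
      rcases ha with rfl | rfl <;> rcases hb with rfl | rfl <;> simp [h])
    intro a ha b hb
    exact setLike_mul_comm ha hb
  rcases ftaux_dichotomy (Subgroup.closure {x, y}) with ⟨f, hf⟩ | ⟨z, -, hz⟩
  · exfalso
    apply ftaux_noncomm
    apply hf
    rw [map_mul, map_mul]
    exact Subtype.ext (hc _ (f _).2 _ (f _).2)
  · obtain ⟨i, hi⟩ := hz x (Subgroup.subset_closure (by simp))
    obtain ⟨j, hj⟩ := hz y (Subgroup.subset_closure (by simp))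
    refine ⟨j, i, ?_, ?_⟩
    · rintro rfl
      exact hy (by rw [← hj, zpow_zero])
    · rw [← hi, ← hj, ← zpow_mul, ← zpow_mul, mul_comm]

theorem ftaux_center (x : FreeGroup (Fin 2)) (h : ∀ g, x * (g * g) = (g * g) * x) : x = 1 := by
  have hne : ∀ i : Fin 2, FreeGroup.of i * FreeGroup.of i ≠ 1 := by decide
  obtain ⟨m, k, hm, h1⟩ := ftaux_commute x _ (h (FreeGroup.of 0)) (hne 0)
  obtain ⟨m', k', hm', h2⟩ := ftaux_commute x _ (h (FreeGroup.of 1)) (hne 1)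
  rw [← pow_two, ← zpow_natCast, ← zpow_mul] at h1 h2
  have h3 : x ^ (m * m') = FreeGroup.of 0 ^ ((2 : ℕ) * k * m') := by
    rw [zpow_mul, h1, ← zpow_mul]
  have h4 : x ^ (m * m') = FreeGroup.of 1 ^ ((2 : ℕ) * k' * m) := by
    rw [mul_comm, zpow_mul, h2, ← zpow_mul]
  have h5 : ((2 : ℕ) * k * m' : ℤ) = 0 := by
    apply ftaux_of_pow 0
    rw [← h3, h4, map_zpow]
    simp [ftauxExp]
  rw [h5, zpow_zero] at h3
  exact (IsMulTorsionFree.zpow_eq_one_iff_left (mul_ne_zero hm hm')).1 h3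

theorem ftaux_normal (K : Subgroup (FreeGroup (Fin 2))) [hK : K.Normal] (x : FreeGroup (Fin 2))
    (hx : x ∈ K) (hx1 : x ≠ 1) : ∃ f : FreeGroup (Fin 2) →* K, Function.Injective f := by
  rcases ftaux_dichotomy K with h | ⟨z, hzK, hz⟩
  · exact h
  exfalso
  have hz1 : z ≠ 1 := by
    rintro rfl
    obtain ⟨n, hn⟩ := hz x hx
    exact hx1 (by rw [← hn, one_zpow])
  apply hz1
  apply ftaux_center
  intro g
  obtain ⟨m, hm⟩ := hz _ (hK.conj_mem z hzK g)
  obtain ⟨k, hk⟩ := hz _ (hK.conj_mem z hzK g⁻¹)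
  rw [inv_inv] at hk
  have h1 : z ^ (m * k) = z := by
    rw [zpow_mul, hm, conj_zpow, hk]; group
  have h2 : m * k = 1 := by
    have : z ^ (m * k - 1) = 1 := by rw [zpow_sub, h1]; simp
    by_contra hne
    exact hz1 ((IsMulTorsionFree.zpow_eq_one_iff_left (sub_ne_zero.2 hne)).1 this)
  have h3 : m * m = 1 := by
    rcases Int.eq_one_or_neg_one_of_mul_eq_one h2 with h | h <;> simp [h]
  have h4 : g * g * z * (g * g)⁻¹ = z := by
    calc g * g * z * (g * g)⁻¹ = g * (g * z * g⁻¹) * g⁻¹ := by group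
      _ = z ^ (m * m) := by rw [← hm, ← conj_zpow, ← hm, zpow_mul]
      _ = z := by rw [h3, zpow_one]
  exact (mul_inv_eq_iff_eq_mul.1 h4).symm

theorem ftaux_main {G Q : Type*} [Group G] [Group Q] (p : G →* Q)
    (hker : ¬ ∃ N : Subgroup G, N ≤ p.ker ∧ Nonempty (N ≃* FreeGroup (Fin 2)))
    (n : ℕ) (f : (Fin n → FreeGroup (Fin 2)) →* G) (hf : Function.Injective f) :
    Function.Injective (p.comp f) := by
  rw [injective_iff_map_eq_one]
  intro k hk
  by_contra hk1
  obtain ⟨i, hi⟩ := Function.ne_iff.1 hk1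
  have hg : ∃ g, k i * g ≠ g * k i := by
    by_contra! hcon
    exact hi (ftaux_center _ fun g => hcon (g * g))
  obtain ⟨g, hg⟩ := hg
  let s : FreeGroup (Fin 2) →* (Fin n → FreeGroup (Fin 2)) :=
    MonoidHom.mulSingle (fun _ => FreeGroup (Fin 2)) i
  have hs : Function.Injective s := by
    intro a b hab
    have := congrFun hab i
    simpa [s] using this
  let q := (p.comp f).comp s
  have hc : s (k i * g * (k i)⁻¹ * g⁻¹) = k * s g * k⁻¹ * (s g)⁻¹ := by
    funext j
    by_cases hj : j = i
    · subst hj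
      simp [s]
    · simp [s, hj]
  have hmem : k i * g * (k i)⁻¹ * g⁻¹ ∈ q.ker := by
    rw [MonoidHom.mem_ker]
    change (p.comp f) (s _) = 1
    rw [hc]
    simp only [map_mul, map_inv, hk]
    simp
  obtain ⟨F, hF⟩ := ftaux_normal q.ker _ hmem (by
    intro h
    apply hg
    rw [mul_inv_eq_one, mul_inv_eq_iff_eq_mul] at h
    exact h)
  let φ : FreeGroup (Fin 2) →* G := (f.comp s).comp (q.ker.subtype.comp F)
  have hφ : Function.Injective φ := (hf.comp hs).comp (Subtype.val_injective.comp hF)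
  refine hker ⟨φ.range, ?_, ⟨(MonoidHom.ofInjective hφ).symm⟩⟩
  rintro _ ⟨w, rfl⟩
  exact (F w).2

theorem free_torus_descends_through_quotient {G Q : Type*} [Group G] [Group Q]
    (p : G →* Q) (hsurj : Function.Surjective p)
    (hker : ¬ ∃ N : Subgroup G, N ≤ p.ker ∧ Nonempty (N ≃* FreeGroup (Fin 2))) :
    (∀ n : ℕ, ∀ H : Subgroup G, (H ≃* (Fin n → FreeGroup (Fin 2))) →
        Function.Injective (p.comp H.subtype)) ∧
    (∀ n : ℕ, FreeTorusEmbeds n G → FreeTorusEmbeds n Q) ∧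
    freeSubgroupRank G ≤ freeSubgroupRank Q := by
  have h2 : ∀ n : ℕ, FreeTorusEmbeds n G → FreeTorusEmbeds n Q := by
    rintro n ⟨f, hf⟩
    exact ⟨p.comp f, ftaux_main p hker n f hf⟩
  refine ⟨?_, h2, ?_⟩
  · intro n H e
    have := ftaux_main p hker n (H.subtype.comp e.symm.toMonoidHom)
      (H.subtype_injective.comp e.symm.injective)
    intro a b hab
    apply e.injective
    apply this
    simpa using hab
  · apply sSup_le_sSup
    rintro c ⟨n, hc, hn⟩
    exact ⟨n, hc, h2 n hn⟩
end

section
/- The matrices A = [[1,2],[0,1]] and B = [[1,0],[2,1]] in SL₂(ℤ) generate a free subgroup of rank two (equivalently, the homomorphism from F₂ to SL₂(ℤ) sending the two free generators to A and B is injective), and this subgroup has finite index in SL₂(ℤ). -/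
/-- The matrix `[[1, 2], [0, 1]]` as an element of `SL₂(ℤ)`. -/
def sanovA : Matrix.SpecialLinearGroup (Fin 2) ℤ :=
  ⟨!![1, 2; 0, 1], by simp [Matrix.det_fin_two_of]⟩

/-- The matrix `[[1, 0], [2, 1]]` as an element of `SL₂(ℤ)`. -/
def sanovB : Matrix.SpecialLinearGroup (Fin 2) ℤ :=
  ⟨!![1, 0; 2, 1], by simp [Matrix.det_fin_two_of]⟩

open scoped Pointwise Function MatrixGroups

theorem sanovA_coe : (sanovA : Matrix (Fin 2) (Fin 2) ℤ) = !![1, 2; 0, 1] := rfl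

theorem sanovB_coe : (sanovB : Matrix (Fin 2) (Fin 2) ℤ) = !![1, 0; 2, 1] := rfl

theorem sanovA_zero (g : SL(2, ℤ)) (j : Fin 2) : (sanovA * g) 0 j = g 0 j + 2 * g 1 j := by
  simp [sanovA_coe, Matrix.mul_apply, Fin.sum_univ_two]

theorem sanovA_one (g : SL(2, ℤ)) (j : Fin 2) : (sanovA * g) 1 j = g 1 j := by
  simp [sanovA_coe, Matrix.mul_apply, Fin.sum_univ_two]

theorem sanovB_zero (g : SL(2, ℤ)) (j : Fin 2) : (sanovB * g) 0 j = g 0 j := by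
  simp [sanovB_coe, Matrix.mul_apply, Fin.sum_univ_two]

theorem sanovB_one (g : SL(2, ℤ)) (j : Fin 2) : (sanovB * g) 1 j = 2 * g 0 j + g 1 j := by
  simp [sanovB_coe, Matrix.mul_apply, Fin.sum_univ_two]

theorem sanov_inj : Function.Injective (FreeGroup.lift ![sanovA, sanovB]) := by
  have hAp := fun g => sanovA_zero g 0
  have hAq := fun g => sanovA_one g 0
  have hBp := fun g => sanovB_zero g 0
  have hBq := fun g => sanovB_one g 0
  have hne : ∀ g : SL(2, ℤ), 0 < g 0 0 ^ 2 + g 1 0 ^ 2 := by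
    intro g
    have hd := Matrix.det_fin_two g.1
    rw [g.2] at hd
    change 1 = g 0 0 * g 1 1 - g 0 1 * g 1 0 at hd
    by_contra h
    have h0 : g 0 0 = 0 := by nlinarith [sq_nonneg (g 0 0), sq_nonneg (g 1 0)]
    have h1 : g 1 0 = 0 := by nlinarith [sq_nonneg (g 0 0), sq_nonneg (g 1 0)]
    rw [h0, h1] at hd
    simp at hd
  let X : Fin 2 → Set SL(2, ℤ) :=
    ![{g | g 1 0 ^ 2 ≤ g 0 0 * g 1 0}, {g | g 0 0 ^ 2 < g 0 0 * g 1 0}]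
  let Y : Fin 2 → Set SL(2, ℤ) :=
    ![{g | g 0 0 * g 1 0 < - g 1 0 ^ 2}, {g | g 0 0 * g 1 0 ≤ - g 0 0 ^ 2}]
  refine FreeGroup.injective_lift_of_ping_pong (α := SL(2, ℤ)) _ X Y ?_ ?_ ?_ ?_ ?_ ?_
  · intro i
    fin_cases i
    · exact ⟨1, by simp [X]⟩
    · exact ⟨sanovB, by simp [X, sanovB_coe]⟩
  · intro i j hij
    rw [Function.onFun, Set.disjoint_left]
    intro g h1 h2
    fin_cases i <;> fin_cases j <;> simp [X] at hij h1 h2 <;>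
      nlinarith [sq_nonneg (g 0 0 - g 1 0)]
  · intro i j hij
    rw [Function.onFun, Set.disjoint_left]
    intro g h1 h2
    fin_cases i <;> fin_cases j <;> simp [Y] at hij h1 h2 <;>
      nlinarith [sq_nonneg (g 0 0 + g 1 0)]
  · intro i j
    rw [Set.disjoint_left]
    intro g h1 h2
    have := hne g
    fin_cases i <;> fin_cases j <;> simp [X, Y] at h1 h2 <;>
      nlinarith [sq_nonneg (g 0 0), sq_nonneg (g 1 0)]
  · intro i
    rintro _ ⟨g, hg, rfl⟩
    fin_cases i
    · simp only [X, Y, Fin.zero_eta, Matrix.cons_val_zero, Set.mem_compl_iff, Set.mem_ofPred_eq,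
        smul_eq_mul, hAp, hAq] at hg ⊢
      nlinarith
    · simp only [X, Y, Fin.mk_one, Matrix.cons_val_one, Matrix.cons_val_zero, Set.mem_compl_iff,
        Set.mem_ofPred_eq, smul_eq_mul, hBp, hBq] at hg ⊢
      nlinarith
  · intro i
    rintro _ ⟨g, hg, rfl⟩
    fin_cases i
    · obtain ⟨k, rfl⟩ : ∃ k, g = sanovA * k := ⟨sanovA⁻¹ * g, by simp⟩
      simp only [X, Y, Fin.zero_eta, Matrix.cons_val_zero, Set.mem_compl_iff, Set.mem_ofPred_eq,
        smul_eq_mul, hAp, hAq, Pi.inv_apply, inv_mul_cancel_left] at hg ⊢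
      nlinarith
    · obtain ⟨k, rfl⟩ : ∃ k, g = sanovB * k := ⟨sanovB⁻¹ * g, by simp⟩
      simp only [X, Y, Fin.mk_one, Matrix.cons_val_one, Matrix.cons_val_zero, Set.mem_compl_iff,
        Set.mem_ofPred_eq, smul_eq_mul, hBp, hBq, Pi.inv_apply, inv_mul_cancel_left] at hg ⊢
      nlinarith

theorem sanov_mem (H : Subgroup SL(2, ℤ)) (hA : sanovA ∈ H) (hB : sanovB ∈ H) (n : ℕ) :
    ∀ g : SL(2, ℤ), (g 0 0).natAbs + (g 1 0).natAbs = n → g 0 0 % 4 = 1 → g 1 0 % 2 = 0 →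
      g 0 1 % 2 = 0 → g ∈ H := by
  induction n using Nat.strong_induction_on with
  | _ n ih =>
  intro g hn hp hq hb
  have hd := Matrix.det_fin_two g.1
  rw [g.2] at hd
  change 1 = g 0 0 * g 1 1 - g 0 1 * g 1 0 at hd
  have key : ∀ h ∈ H, (((h * g) 0 0).natAbs + ((h * g) 1 0).natAbs < n ∧ (h * g) 0 0 % 4 = 1 ∧
      (h * g) 1 0 % 2 = 0 ∧ (h * g) 0 1 % 2 = 0) → g ∈ H := by
    rintro h hh ⟨h1, h2, h3, h4⟩
    exact (H.mul_mem_cancel_left hh).1 (ih _ h1 _ rfl h2 h3 h4)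
  by_cases h0 : g 1 0 = 0
  · rw [h0, mul_zero, sub_zero] at hd
    have hp1 : g 0 0 = 1 := by
      rcases Int.eq_one_or_neg_one_of_mul_eq_one hd.symm with h | h <;> omega
    have hd1 : g 1 1 = 1 := by rw [hp1] at hd; omega
    obtain ⟨k, hk⟩ : ∃ k, g 0 1 = 2 * k := ⟨g 0 1 / 2, by omega⟩
    have hAT : sanovA = ModularGroup.T ^ (2 : ℤ) := by
      ext i j
      rw [ModularGroup.coe_T_zpow]
      fin_cases i <;> fin_cases j <;> simp [sanovA_coe]
    have : g = sanovA ^ k := by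
      rw [hAT, ← zpow_mul]
      ext i j
      rw [ModularGroup.coe_T_zpow]
      fin_cases i <;> fin_cases j <;> simp [hp1, hd1, h0, hk]
    rw [this]
    exact H.zpow_mem hA k
  · rcases lt_or_ge (g 1 0).natAbs (g 0 0).natAbs with hlt | hge
    · by_cases hs : 0 < g 0 0 ↔ 0 < g 1 0
      · apply key sanovA⁻¹ (H.inv_mem hA)
        have e1 := sanovA_zero (sanovA⁻¹ * g)
        have e2 := sanovA_one (sanovA⁻¹ * g)
        simp only [mul_inv_cancel_left] at e1 e2
        have e10 := e1 0
        have e11 := e1 1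
        have e20 := e2 0
        have e21 := e2 1
        omega
      · apply key sanovA hA
        rw [sanovA_zero, sanovA_one, sanovA_zero]
        omega
    · by_cases hs : 0 < g 0 0 ↔ 0 < g 1 0
      · apply key sanovB⁻¹ (H.inv_mem hB)
        have e1 := sanovB_zero (sanovB⁻¹ * g)
        have e2 := sanovB_one (sanovB⁻¹ * g)
        simp only [mul_inv_cancel_left] at e1 e2
        have e10 := e1 0
        have e11 := e1 1
        have e20 := e2 0
        have e21 := e2 1
        omega
      · apply key sanovB hB
        rw [sanovB_zero, sanovB_one, sanovB_zero]
        omega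

theorem sanov_free_and_finite_index :
    Function.Injective (FreeGroup.lift ![sanovA, sanovB]) ∧
      (FreeGroup.lift ![sanovA, sanovB] :
        FreeGroup (Fin 2) →* Matrix.SpecialLinearGroup (Fin 2) ℤ).range.FiniteIndex := by
  refine ⟨sanov_inj, ?_⟩
  have hle : CongruenceSubgroup.Gamma 4 ≤ (FreeGroup.lift ![sanovA, sanovB] :
        FreeGroup (Fin 2) →* Matrix.SpecialLinearGroup (Fin 2) ℤ).range := by
    intro g hg
    rw [CongruenceSubgroup.Gamma_mem] at hg
    obtain ⟨h1, h2, h3, -⟩ := hg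
    have e1 : ((g 0 0 - 1 : ℤ) : ZMod 4) = 0 := by push_cast; rw [h1]; simp
    have h1' := (ZMod.intCast_zmod_eq_zero_iff_dvd _ 4).1 e1
    have h2' := (ZMod.intCast_zmod_eq_zero_iff_dvd _ 4).1 h2
    have h3' := (ZMod.intCast_zmod_eq_zero_iff_dvd _ 4).1 h3
    refine sanov_mem _ (MonoidHom.mem_range.2 ⟨FreeGroup.of 0, by simp⟩)
      (MonoidHom.mem_range.2 ⟨FreeGroup.of 1, by simp⟩) _ g rfl ?_ ?_ ?_ <;>
      omega
  exact Subgroup.finiteIndex_of_le hle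
end

section
/- For every n ≥ 1 there is no injective group homomorphism from (F₂)^{⌊n/2⌋ + 1} into SL_n(ℤ). Together with the existence of an embedding of (F₂)^{⌊n/2⌋}, this gives ν(SL_n(ℤ)) = ⌊n/2⌋. -/
def TSol {K F V : Type*} [Field K] [Group F] [AddCommGroup V] [Module K V]
    (ρ : F →* Module.End K V) : Prop :=
  ∃ m, ∀ g ∈ derivedSeries F m, ρ g = 1

section
variable {K F V : Type*} [Field K] [Group F] [AddCommGroup V] [Module K V]

theorem tsol_of_comm (ρ : F →* Module.End K V) (m : ℕ)
    (h : ∀ a ∈ derivedSeries F m, ∀ b ∈ derivedSeries F m, ρ a * ρ b = ρ b * ρ a) : TSol ρ := by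
  refine ⟨m + 1, ?_⟩
  have : derivedSeries F (m + 1) ≤ ρ.ker := by
    rw [derivedSeries_succ, Subgroup.commutator_le]
    intro a ha b hb
    rw [MonoidHom.mem_ker]
    rw [commutatorElement_def, show a * b * a⁻¹ * b⁻¹ = (a * b) * (b * a)⁻¹ by group, map_mul, map_mul, h a ha b hb, ← map_mul, ← map_mul, mul_inv_cancel, map_one]
  intro g hg
  exact this hg

theorem tsol_of_ext (ρ : F →* Module.End K V) (U : Submodule K V)
    (hU : ∀ g, U ≤ U.comap (ρ g))
    (h1 : TSol (Representation.subrepresentation ρ U hU))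
    (h2 : TSol (Representation.quotient ρ U hU)) : TSol ρ := by
  obtain ⟨m1, h1⟩ := h1
  obtain ⟨m2, h2⟩ := h2
  have k1 : ∀ g ∈ derivedSeries F (max m1 m2), ∀ u ∈ U, ρ g u = u := by
    intro g hg u hu
    have := h1 g (derivedSeries_antitone F (le_max_left _ _) hg)
    have := congrArg Subtype.val (LinearMap.congr_fun this ⟨u, hu⟩)
    simpa using this
  have k2 : ∀ g ∈ derivedSeries F (max m1 m2), ∀ v, ρ g v - v ∈ U := by
    intro g hg v
    have := h2 g (derivedSeries_antitone F (le_max_right _ _) hg)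
    have := LinearMap.congr_fun this (U.mkQ v)
    rw [← Submodule.Quotient.eq]
    simpa using this
  refine tsol_of_comm ρ (max m1 m2) ?_
  intro a ha b hb
  ext v
  have e1 := k1 a ha _ (k2 b hb v)
  have e2 := k1 b hb _ (k2 a ha v)
  rw [map_sub] at e1 e2
  simp only [Module.End.mul_apply]
  rw [sub_eq_iff_eq_add] at e1 e2
  rw [e1, e2]; abel

end

theorem key {K F : Type*} [Field K] [IsAlgClosed K] [Group F] {ι : Type*} [DecidableEq ι] (N : ℕ) :
    ∀ (V : Type) [AddCommGroup V] [Module K V] [FiniteDimensional K V], Module.finrank K V = N →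
    ∀ (s : Finset ι) (ρ : ι → F →* Module.End K V),
      (∀ i ∈ s, ∀ j ∈ s, i ≠ j → ∀ a b, ρ i a * ρ j b = ρ j b * ρ i a) →
      (∀ i ∈ s, ¬ TSol (ρ i)) → 2 * s.card ≤ N := by
  induction N using Nat.strong_induction_on with
  | _ N ih =>
  intro V _ _ _ hN s ρ hc hs
  classical
  by_cases hred : ∃ U : Submodule K V, U ≠ ⊥ ∧ U ≠ ⊤ ∧ ∀ i ∈ s, ∀ g, U ≤ U.comap (ρ i g)
  · obtain ⟨U, hb, ht, hU⟩ := hred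
    have hadd := U.finrank_quotient_add_finrank
    have hlt : Module.finrank K U < N := hN ▸ Submodule.finrank_lt ht
    have hpos : 0 < Module.finrank K U := by
      rw [Module.finrank_pos_iff]; exact Submodule.nontrivial_iff_ne_bot.mpr hb
    let ρ1 : ι → F →* Module.End K U := fun i =>
      if h : i ∈ s then Representation.subrepresentation (ρ i) U (hU i h) else 1
    let ρ2 : ι → F →* Module.End K (V ⧸ U) := fun i =>
      if h : i ∈ s then Representation.quotient (ρ i) U (hU i h) else 1
    have b1 := ih _ hlt U rfl (s.filter fun i => ¬ TSol (ρ1 i)) ρ1 (by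
      intro i hi j hj hij a b
      have hi' := (Finset.mem_filter.1 hi).1
      have hj' := (Finset.mem_filter.1 hj).1
      ext v
      have := LinearMap.congr_fun (hc i hi' j hj' hij a b) (v : V)
      simpa [ρ1, hi', hj'] using this) (fun i hi => (Finset.mem_filter.1 hi).2)
    have b2 := ih (Module.finrank K (V ⧸ U)) (by omega) (V ⧸ U) rfl
      (s.filter fun i => ¬ TSol (ρ2 i)) ρ2 (by
      intro i hi j hj hij a b
      have hi' := (Finset.mem_filter.1 hi).1
      have hj' := (Finset.mem_filter.1 hj).1
      ext v
      have := LinearMap.congr_fun (hc i hi' j hj' hij a b) (v : V)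
      simp only [Module.End.mul_apply] at this
      simp [ρ2, hi', hj', this]) (fun i hi => (Finset.mem_filter.1 hi).2)
    have hsub : s ⊆ (s.filter fun i => ¬ TSol (ρ1 i)) ∪ (s.filter fun i => ¬ TSol (ρ2 i)) := by
      intro i hi
      by_contra hcon
      simp only [Finset.mem_union, Finset.mem_filter, hi, true_and, not_or, not_not] at hcon
      obtain ⟨c1, c2⟩ := hcon
      simp only [ρ1, ρ2, hi, dif_pos] at c1 c2
      exact hs i hi (tsol_of_ext (ρ i) U (hU i hi) c1 c2)
    have := (Finset.card_le_card hsub).trans (Finset.card_union_le _ _)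
    omega
  · push Not at hred
    have hirr : ∀ U : Submodule K V, U ≠ ⊥ → (∀ i ∈ s, ∀ g, U ≤ U.comap (ρ i g)) → U = ⊤ := by
      intro U hb hU
      by_contra ht
      obtain ⟨i, hi, g, h⟩ := hred U hb ht
      exact h (hU i hi g)
    rcases s.eq_empty_or_nonempty with rfl | ⟨i0, hi0⟩
    · simp
    have hcard : (s.erase i0).card + 1 = s.card := Finset.card_erase_add_one hi0
    have hVnt : Nontrivial V := by
      by_contra hV
      rw [not_nontrivial_iff_subsingleton] at hV
      exact hs i0 hi0 ⟨0, fun g _ => LinearMap.ext fun v => Subsingleton.elim _ _⟩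
    obtain ⟨E, ⟨hEb, hEinv⟩, hEmin⟩ := exists_minimal_of_wellFoundedLT
      (fun U : Submodule K V => U ≠ ⊥ ∧ ∀ i ∈ s.erase i0, ∀ g, U ≤ U.comap (ρ i g))
      ⟨⊤, top_ne_bot, fun i _ g => by simp⟩
    have hEmin' : ∀ U : Submodule K V, U ≠ ⊥ → (∀ i ∈ s.erase i0, ∀ g, U ≤ U.comap (ρ i g)) →
        U ≤ E → E ≤ U := fun U h1 h2 h3 => hEmin ⟨h1, h2⟩ h3
    have hinj : ∀ i g, Function.Injective (ρ i g) := by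
      intro i g
      apply Function.LeftInverse.injective (g := ρ i g⁻¹)
      intro v
      rw [← Module.End.mul_apply, ← map_mul]; simp
    have hEpos : 0 < Module.finrank K E := by
      rw [Module.finrank_pos_iff]; exact Submodule.nontrivial_iff_ne_bot.mpr hEb
    by_cases hEt : E = ⊤
    · -- scalars
      exfalso
      have hscal : ∀ g, ∃ μ : K, ∀ v, ρ i0 g v = μ • v := by
        intro g
        obtain ⟨μ, hμ⟩ := Module.End.exists_eigenvalue (ρ i0 g)
        refine ⟨μ, ?_⟩
        have := hEmin' (Module.End.eigenspace (ρ i0 g) μ) hμ (by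
          intro i hi a v hv
          rw [Submodule.mem_comap, Module.End.mem_eigenspace_iff] at *
          have := LinearMap.congr_fun (hc i0 hi0 i (Finset.mem_of_mem_erase hi)
            (Finset.ne_of_mem_erase hi).symm g a) v
          simp only [Module.End.mul_apply] at this
          rw [this, hv, map_smul]) (hEt ▸ le_top)
        intro v
        exact Module.End.mem_eigenspace_iff.1 (this (hEt ▸ Submodule.mem_top))
      refine hs i0 hi0 (tsol_of_comm _ 0 ?_)
      intro a _ b _
      obtain ⟨x, hx⟩ := hscal a
      obtain ⟨y, hy⟩ := hscal b
      ext v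
      simp only [Module.End.mul_apply, hx, hy]
      rw [smul_comm]
    · -- some translate differs
      obtain ⟨g, hg⟩ : ∃ g, ¬ E ≤ E.comap (ρ i0 g) := by
        by_contra hcon
        push Not at hcon
        apply hEt
        apply hirr E hEb
        intro i hi
        by_cases h : i = i0
        · subst h; exact hcon
        · exact hEinv i (Finset.mem_erase.2 ⟨h, hi⟩)
      have hdisj : E ⊓ E.map (ρ i0 g) = ⊥ := by
        by_contra hne
        have h1 := hEmin' _ hne (by
          intro i hi a v hv
          rw [Submodule.mem_comap]
          refine ⟨hEinv i hi a hv.1, ?_⟩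
          obtain ⟨w, hw, rfl⟩ := hv.2
          refine ⟨ρ i a w, hEinv i hi a hw, ?_⟩
          exact LinearMap.congr_fun (hc i0 hi0 i (Finset.mem_of_mem_erase hi)
            (Finset.ne_of_mem_erase hi).symm g a) w) inf_le_left
        have h2 : E ≤ E.map (ρ i0 g) := h1.trans inf_le_right
        have h3 := Submodule.eq_of_le_of_finrank_eq h2
          (LinearEquiv.finrank_eq (Submodule.equivMapOfInjective _ (hinj i0 g) E))
        apply hg
        rw [← Submodule.map_le_iff_le_comap]
        exact h3.symm.le
      have hdim : 2 * Module.finrank K E ≤ N := by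
        have h1 := Submodule.finrank_sup_add_finrank_inf_eq E (E.map (ρ i0 g))
        rw [hdisj, finrank_bot,
          ← LinearEquiv.finrank_eq (Submodule.equivMapOfInjective _ (hinj i0 g) E)] at h1
        have h2 := Submodule.finrank_le (E ⊔ E.map (ρ i0 g))
        omega
      -- span of translates
      have hspan : (⨆ g : F, E.map (ρ i0 g)) = ⊤ := by
        apply hirr
        · intro hb
          apply hEb
          rw [eq_bot_iff, ← hb]
          refine le_trans ?_ (le_iSup _ (1 : F))
          intro v hv
          exact ⟨v, hv, by simp⟩
        · intro i hi a
          refine iSup_le fun b => ?_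
          by_cases h : i = i0
          · subst h
            rintro _ ⟨v, hv, rfl⟩
            rw [Submodule.mem_comap]
            refine Submodule.mem_iSup_of_mem (a * b) ⟨v, hv, ?_⟩
            simp
          · rintro _ ⟨v, hv, rfl⟩
            rw [Submodule.mem_comap]
            refine Submodule.mem_iSup_of_mem b
              ⟨ρ i a v, hEinv i (Finset.mem_erase.2 ⟨h, hi⟩) a hv, ?_⟩
            exact LinearMap.congr_fun (hc i0 hi0 i hi (Ne.symm h) b a) v
      let ρ1 : ι → F →* Module.End K E := fun i =>
        if h : i ∈ s.erase i0 then Representation.subrepresentation (ρ i) E (hEinv i h) else 1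
      have b1 := ih _ (by omega) E rfl (s.erase i0) ρ1 (by
        intro i hi j hj hij a b
        ext v
        have := LinearMap.congr_fun (hc i (Finset.mem_of_mem_erase hi) j
          (Finset.mem_of_mem_erase hj) hij a b) (v : V)
        simp only [ρ1, dif_pos hi, dif_pos hj]
        simpa using this) (by
        rintro i hi ⟨m, hm⟩
        apply hs i (Finset.mem_of_mem_erase hi)
        refine ⟨m, fun a ha => ?_⟩
        have h0 := hm a ha
        simp only [ρ1, dif_pos hi] at h0
        have hle : (⨆ g : F, E.map (ρ i0 g)) ≤ LinearMap.eqLocus (ρ i a) 1 := by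
          refine iSup_le fun b => ?_
          rintro _ ⟨v, hv, rfl⟩
          rw [LinearMap.mem_eqLocus]
          have h2 := LinearMap.congr_fun (hc i0 hi0 i (Finset.mem_of_mem_erase hi)
            (Finset.ne_of_mem_erase hi).symm b a) v
          have h3 := congrArg Subtype.val (LinearMap.congr_fun h0 ⟨v, hv⟩)
          simp only [Module.End.mul_apply] at h2
          rw [← h2]
          have h4 : ρ i a v = v := by simpa using h3
          simp [h4]
        rw [hspan] at hle
        ext v
        exact hle (Submodule.mem_top (x := v)))
      omega

theorem free_not_solvable : ¬ Group.IsSolvable (FreeGroup (Fin 2)) := by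
  intro h
  let σ : Equiv.Perm (Fin 5) := finRotate 5
  let f : FreeGroup (Fin 2) →* Equiv.Perm (Fin 5) :=
    FreeGroup.lift ![σ, Equiv.swap 0 (σ 0)]
  have hf : Function.Surjective f := by
    rw [← MonoidHom.range_eq_top, eq_top_iff,
      ← Equiv.Perm.closure_cycle_adjacent_swap (σ := σ) isCycle_finRotate support_finRotate 0,
      Subgroup.closure_le]
    rintro x (rfl | rfl)
    · exact ⟨FreeGroup.of 0, by simp [f]⟩
    · exact ⟨FreeGroup.of 1, by simp [f]⟩
  exact Equiv.Perm.not_isSolvable_fin_5 (Group.isSolvable_of_surjective hf)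

theorem upper (n k : ℕ) (f : (Fin k → FreeGroup (Fin 2)) →* Matrix.SpecialLinearGroup (Fin n) ℤ)
    (hf : Function.Injective f) : 2 * k ≤ n := by
  let M : Matrix.SpecialLinearGroup (Fin n) ℤ →* Module.End ℂ (Fin n → ℂ) :=
    ((Matrix.toLinAlgEquiv' (R := ℂ) (n := Fin n)).toRingEquiv.toRingHom.toMonoidHom.comp
      ((Int.castRingHom ℂ).mapMatrix.toMonoidHom)).comp
      (⟨⟨fun A => A.1, rfl⟩, fun _ _ => rfl⟩ :
        Matrix.SpecialLinearGroup (Fin n) ℤ →* Matrix (Fin n) (Fin n) ℤ)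
  have hM : Function.Injective M := by
    intro a b hab
    have h1 := (Matrix.toLinAlgEquiv' (R := ℂ) (n := Fin n)).injective hab
    ext i j
    have := congrFun (congrFun h1 i) j
    simpa using this
  have := key (K := ℂ) (F := FreeGroup (Fin 2)) n (Fin n → ℂ) (by simp) (Finset.univ : Finset (Fin k))
    (fun i => (M.comp f).comp (MonoidHom.mulSingle (fun _ : Fin k => FreeGroup (Fin 2)) i)) (by
      intro i _ j _ hij a b
      have := (Pi.mulSingle_commute (f := fun _ : Fin k => FreeGroup (Fin 2)) hij a b).eq
      simp only [MonoidHom.comp_apply, ← map_mul, MonoidHom.mulSingle_apply]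
      rw [this]) (by
      rintro i _ ⟨m, hm⟩
      apply free_not_solvable
      refine ⟨m, ?_⟩
      rw [eq_bot_iff]
      intro g hg
      have h := hm g hg
      simp only [MonoidHom.comp_apply] at h
      rw [← map_one M] at h
      have h := hM h
      rw [← map_one f] at h
      have h := hf h
      rw [Subgroup.mem_bot]
      simpa using h)
  simpa using this

def sanovHom : Fin 2 → (FreeGroup Unit →* Matrix.SpecialLinearGroup (Fin 2) ℤ) := fun i =>
  FreeGroup.lift fun _ => if i = 0 then ⟨!![1, 2; 0, 1], by simp⟩ else ⟨!![1, 0; 2, 1], by simp⟩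

theorem pow_a (A : Matrix.SpecialLinearGroup (Fin 2) ℤ) (hA : A.1 = !![1, 2; 0, 1]) (n : ℤ) :
    (A ^ n).1 = !![1, 2 * n; 0, 1] := by
  induction n using Int.induction_on with
  | zero => ext i j; fin_cases i <;> fin_cases j <;> simp
  | succ n ih =>
    rw [zpow_add_one, Matrix.SpecialLinearGroup.coe_mul, ih, hA]
    ext i j; fin_cases i <;> fin_cases j <;> simp [Matrix.mul_apply]; ring
  | pred n ih =>
    rw [zpow_sub_one, Matrix.SpecialLinearGroup.coe_mul, ih, Matrix.SpecialLinearGroup.coe_inv, hA,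
      Matrix.adjugate_fin_two]
    ext i j; fin_cases i <;> fin_cases j <;> simp [Matrix.mul_apply]; ring

theorem pow_b (A : Matrix.SpecialLinearGroup (Fin 2) ℤ) (hA : A.1 = !![1, 0; 2, 1]) (n : ℤ) :
    (A ^ n).1 = !![1, 0; 2 * n, 1] := by
  induction n using Int.induction_on with
  | zero => ext i j; fin_cases i <;> fin_cases j <;> simp
  | succ n ih =>
    rw [zpow_add_one, Matrix.SpecialLinearGroup.coe_mul, ih, hA]
    ext i j; fin_cases i <;> fin_cases j <;> simp [Matrix.mul_apply]; ring
  | pred n ih =>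
    rw [zpow_sub_one, Matrix.SpecialLinearGroup.coe_mul, ih, Matrix.SpecialLinearGroup.coe_inv, hA,
      Matrix.adjugate_fin_two]
    ext i j; fin_cases i <;> fin_cases j <;> simp [Matrix.mul_apply]; ring

theorem pp_arith (x y n : ℤ) (hn : n ≠ 0) (h : |x| < |y|) : |y| < |x + 2 * n * y| := by
  have h1 : 1 ≤ |n| := Int.one_le_abs hn
  have h2 : |2 * n * y| = 2 * |n| * |y| := by simp [abs_mul]
  have h3 : |2 * n * y| ≤ |x + 2 * n * y| + |x| := by
    have := abs_sub (x + 2 * n * y) x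
    simpa using this
  nlinarith [abs_nonneg y]

theorem sanovHom_zero : (sanovHom 0 (FreeGroup.of ())).1 = !![1, 2; 0, 1] := by
  unfold sanovHom
  rw [FreeGroup.lift_apply_of]
  rfl

theorem sanovHom_one : (sanovHom 1 (FreeGroup.of ())).1 = !![1, 0; 2, 1] := by
  unfold sanovHom
  rw [FreeGroup.lift_apply_of]
  rfl

def sanovSet : Fin 2 → Set (Fin 2 → ℤ) := fun i =>
  if i = 0 then {v | |v 1| < |v 0|} else {v | |v 0| < |v 1|}

open scoped Pointwise in
theorem sanov : ∃ f : FreeGroup (Fin 2) →* Matrix.SpecialLinearGroup (Fin 2) ℤ,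
    Function.Injective f := by
  refine ⟨(Monoid.CoprodI.lift sanovHom).comp (@freeGroupEquivCoprodI (Fin 2)).toMonoidHom, ?_⟩
  rw [MonoidHom.coe_comp]
  refine Function.Injective.comp ?_ (MulEquiv.injective freeGroupEquivCoprodI)
  let _ : MulAction (Matrix.SpecialLinearGroup (Fin 2) ℤ) (Fin 2 → ℤ) :=
    MulAction.compHom _ (Matrix.SpecialLinearGroup.toLin' (n := Fin 2) (R := ℤ))
  have hsm : ∀ (A : Matrix.SpecialLinearGroup (Fin 2) ℤ) (v : Fin 2 → ℤ),
      A • v = A.1.mulVec v := fun A v => rfl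
  refine Monoid.CoprodI.lift_injective_of_ping_pong sanovHom ?_ sanovSet ?_ ?_ ?_
  · right
    refine ⟨0, ?_⟩
    rw [FreeGroup.freeGroupUnitEquivInt.cardinal_eq, Cardinal.mk_denumerable]
    exact Cardinal.natCast_le_aleph0
  · intro i
    fin_cases i
    · exact ⟨![1, 0], by simp [sanovSet]⟩
    · exact ⟨![0, 1], by simp [sanovSet]⟩
  · intro i j hij
    rw [Function.onFun, Set.disjoint_left]
    fin_cases i <;> fin_cases j <;> simp [sanovSet] at hij ⊢ <;> intros <;> omega
  · intro i j hij
    refine FreeGroup.freeGroupUnitEquivInt.forall_congr_left.mpr ?_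
    intro n hne1
    change sanovHom i (FreeGroup.of () ^ n) • sanovSet j ⊆ sanovSet i
    have hn : n ≠ 0 := by
      rintro rfl
      apply hne1
      simp [FreeGroup.freeGroupUnitEquivInt]
    rw [map_zpow]
    rintro _ ⟨v, hv, rfl⟩
    change sanovHom i (FreeGroup.of ()) ^ n • v ∈ _
    rw [hsm]
    fin_cases i <;> fin_cases j
    · exact absurd rfl hij
    · have h0 : |v 0| < |v 1| := by simpa [sanovSet] using hv
      have := pp_arith _ _ n hn h0
      change (sanovHom 0 (FreeGroup.of ()) ^ n).1.mulVec v ∈ sanovSet 0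
      rw [pow_a _ sanovHom_zero]
      simpa [sanovSet, Matrix.mulVec, dotProduct] using this
    · have h0 : |v 1| < |v 0| := by simpa [sanovSet] using hv
      have := pp_arith _ _ n hn h0
      change (sanovHom 1 (FreeGroup.of ()) ^ n).1.mulVec v ∈ sanovSet 1
      rw [pow_b _ sanovHom_one]
      simpa [sanovSet, Matrix.mulVec, dotProduct, add_comm] using this
    · exact absurd rfl hij

theorem lower (n : ℕ) : ∃ f : (Fin (n / 2) → FreeGroup (Fin 2)) →*
    Matrix.SpecialLinearGroup (Fin n) ℤ, Function.Injective f := by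
  obtain ⟨g, hg⟩ := sanov
  obtain ⟨e⟩ : Nonempty ((Fin 2 × Fin (n / 2)) ⊕ Fin (n % 2) ≃ Fin n) := by
    apply Fintype.card_eq.1
    simp only [Fintype.card_sum, Fintype.card_prod, Fintype.card_fin]
    omega
  let B : (Fin (n / 2) → FreeGroup (Fin 2)) → Matrix (Fin n) (Fin n) ℤ := fun x =>
    Matrix.reindex e e (Matrix.fromBlocks (Matrix.blockDiagonal fun i => (g (x i)).1) 0 0 1)
  have hdet : ∀ x, (B x).det = 1 := by
    intro x
    simp [B]
  have hmul : ∀ x y, B (x * y) = B x * B y := by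
    intro x y
    simp only [B, Matrix.reindex_apply, Matrix.submatrix_mul_equiv, Matrix.fromBlocks_multiply]
    congr 1
    simp [← Matrix.blockDiagonal_mul]
  refine ⟨MonoidHom.mk' (fun x => ⟨B x, hdet x⟩) fun x y => Subtype.ext (hmul x y), ?_⟩
  intro x y hxy
  have h1 : B x = B y := congrArg Subtype.val hxy
  have h2 := (Matrix.reindex e e).injective h1
  have h3 := (Matrix.fromBlocks_inj.1 h2).1
  have h4 := Matrix.blockDiagonal_injective h3
  funext i
  exact hg (Subtype.ext (congrFun h4 i))

theorem no_large_free_torus_in_SL_n_Z (n : ℕ) (hn : 1 ≤ n) :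
    (¬ FreeTorusEmbeds (n / 2 + 1) (Matrix.SpecialLinearGroup (Fin n) ℤ)) ∧
      freeSubgroupRank (Matrix.SpecialLinearGroup (Fin n) ℤ) = (n / 2 : ℕ) := by
  constructor
  · rintro ⟨f, hf⟩
    have := upper n _ f hf
    omega
  · unfold freeSubgroupRank
    apply le_antisymm
    · apply sSup_le
      rintro c ⟨k, rfl, f, hf⟩
      have := upper n k f hf
      exact_mod_cast (by omega : k ≤ n / 2)
    · exact le_sSup ⟨n / 2, rfl, lower n⟩
end

section
/- There is no injective group homomorphism from F₂ × F₂ into SL₃(ℂ); that is, ν(SL₃(ℂ)) = 1. -/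
open Matrix

set_option linter.unusedSimpArgs false
set_option linter.unnecessarySeqFocus false

def gx : FreeGroup (Fin 2) := FreeGroup.of 0
def gy : FreeGroup (Fin 2) := FreeGroup.of 1
def gc : FreeGroup (Fin 2) := gx * gy * gx⁻¹ * gy⁻¹
def gd : FreeGroup (Fin 2) := gx * gy⁻¹ * gx⁻¹ * gy
def ge : FreeGroup (Fin 2) := gc * gd * gc⁻¹ * gd⁻¹
theorem gt1 : gc ≠ 1 := by decide
theorem gt2 : gc * gc ≠ 1 := by decide
theorem gt3 : gc * gd ≠ gd * gc := by decide
theorem gt4 : ge * gc ≠ gc * ge := by decide +kernel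
theorem gt5 : gx * gy ≠ gy * gx := by decide
theorem gr1 : gc * (gy * gx) = gx * gy := by simp [gc, mul_assoc]
theorem gr2 : gd * (gy⁻¹ * gx) = gx * gy⁻¹ := by simp [gd, mul_assoc]
theorem gr3 : ge * (gd * gc) = gc * gd := by simp [ge, mul_assoc]

abbrev M3 := Matrix (Fin 3) (Fin 3) ℂ

theorem rank_one (N : M3) (h : N ≠ 0) (h2 : N.adjugate = 0) : ∃ v w, N = vecMulVec v w := by
  have : ∃ i j, N i j ≠ 0 := by
    by_contra! hh
    exact h (by ext i j; simp [hh])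
  obtain ⟨i, j, hij⟩ := this
  refine ⟨fun k => N k j / N i j, fun l => N i l, ?_⟩
  ext k l
  rw [vecMulVec_apply]
  field_simp
  have H := fun a b => congrFun (congrFun h2 a) b
  rw [Matrix.adjugate_fin_three] at H
  have H0 := H 0 0
  have H1 := H 0 1
  have H2 := H 0 2
  have H3 := H 1 0
  have H4 := H 1 1
  have H5 := H 1 2
  have H6 := H 2 0
  have H7 := H 2 1
  have H8 := H 2 2
  simp at H0 H1 H2 H3 H4 H5 H6 H7 H8
  clear hij H h2 h
  fin_cases i <;> fin_cases j <;> fin_cases k <;> fin_cases l <;> simp <;> grind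

theorem col_nf (v : Fin 3 → ℂ) (hv : v ≠ 0) :
    ∃ P : M3, P.det ≠ 0 ∧ P *ᵥ ![1, 0, 0] = v := by
  by_cases h0 : v 0 = 0
  · by_cases h1 : v 1 = 0
    · have h2 : v 2 ≠ 0 := by
        intro h2; apply hv; ext i; fin_cases i <;> simp [h0, h1, h2]
      refine ⟨!![v 0, 1, 0; v 1, 0, 1; v 2, 0, 0], by simp [det_fin_three, h2], ?_⟩
      ext i; fin_cases i <;> simp [mulVec, dotProduct, Fin.sum_univ_three]
    · refine ⟨!![v 0, 1, 0; v 1, 0, 0; v 2, 0, 1], by simp [det_fin_three, h1], ?_⟩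
      ext i; fin_cases i <;> simp [mulVec, dotProduct, Fin.sum_univ_three]
  · refine ⟨!![v 0, 0, 0; v 1, 1, 0; v 2, 0, 1], by simp [det_fin_three, h0], ?_⟩
    ext i; fin_cases i <;> simp [mulVec, dotProduct, Fin.sum_univ_three]

/-- second step -/
theorem row_nf (w : Fin 3 → ℂ) (hw : w ≠ 0) :
    ∃ Q : M3, Q.det ≠ 0 ∧ ((∃ s : ℂ, s ≠ 0 ∧
      Q * vecMulVec ![1, 0, 0] w = !![s, 0, 0; 0, 0, 0; 0, 0, 0] * Q) ∨
      Q * vecMulVec ![1, 0, 0] w = !![0, 0, 1; 0, 0, 0; 0, 0, 0] * Q) := by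
  by_cases h0 : w 0 = 0
  · by_cases h2 : w 2 = 0
    · have h1 : w 1 ≠ 0 := by
        intro h1; apply hw; ext i; fin_cases i <;> simp [h0, h1, h2]
      refine ⟨!![1, 0, 0; 0, 0, 1; 0, w 1, 0], by simp [det_fin_three, h1], Or.inr ?_⟩
      ext i j; fin_cases i <;> fin_cases j <;>
        simp only [mul_apply, vecMulVec_apply, Fin.sum_univ_three] <;> simp [h0, h2]
    · refine ⟨!![1, 0, 0; 0, 1, 0; 0, w 1, w 2], by simp [det_fin_three, h2], Or.inr ?_⟩
      ext i j; fin_cases i <;> fin_cases j <;>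
        simp only [mul_apply, vecMulVec_apply, Fin.sum_univ_three] <;> simp [h0]
  · refine ⟨!![w 0, w 1, w 2; 0, 1, 0; 0, 0, 1], by simp [det_fin_three, h0],
      Or.inl ⟨w 0, h0, ?_⟩⟩
    ext i j; fin_cases i <;> fin_cases j <;>
        simp only [mul_apply, vecMulVec_apply, Fin.sum_univ_three] <;> simp

abbrev E00 : M3 := !![1, 0, 0; 0, 0, 0; 0, 0, 0]
abbrev E02 : M3 := !![0, 0, 1; 0, 0, 0; 0, 0, 0]

/-- normal form: conjugating by a unit -/
theorem nf (R : M3) (h : R ≠ 0) (h2 : R.adjugate = 0) :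
    ∃ P : GL (Fin 3) ℂ, (∃ s : ℂ, s ≠ 0 ∧ (P : M3) * R = s • E00 * P) ∨ (P : M3) * R = E02 * P := by
  obtain ⟨v, w, rfl⟩ := rank_one R h h2
  have hv : v ≠ 0 := by rintro rfl; simp at h
  have hw : w ≠ 0 := by rintro rfl; simp at h
  obtain ⟨P, hP, hPv⟩ := col_nf v hv
  have hPu : IsUnit P.det := isUnit_iff_ne_zero.mpr hP
  have hw' : w ᵥ* P ≠ 0 := by
    intro h0
    apply hw
    have := congrArg (fun z => z ᵥ* P⁻¹) h0
    simpa [vecMul_vecMul, Matrix.mul_nonsing_inv _ hPu] using this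
  obtain ⟨Q, hQ, hQ'⟩ := row_nf _ hw'
  have key : P⁻¹ * vecMulVec v w = vecMulVec ![1,0,0] (w ᵥ* P) * P⁻¹ := by
    rw [← hPv, Matrix.mul_vecMulVec, Matrix.vecMulVec_mul, vecMul_vecMul, Matrix.mul_nonsing_inv _ hPu,
      mulVec_mulVec, Matrix.nonsing_inv_mul _ hPu]
    simp only [one_mulVec, vecMul_one]
  refine ⟨Matrix.GeneralLinearGroup.mkOfDetNeZero (Q * P⁻¹) ?_, ?_⟩
  · rw [det_mul, det_nonsing_inv]
    simp [hQ, hP]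
  · have e : ((Matrix.GeneralLinearGroup.mkOfDetNeZero (Q * P⁻¹) (by
        rw [det_mul, det_nonsing_inv]; simp [hQ, hP]) : GL (Fin 3) ℂ) : M3) = Q * P⁻¹ := rfl
    rw [e]
    rcases hQ' with ⟨s, hs, h⟩ | h
    · refine Or.inl ⟨s, hs, ?_⟩
      rw [Matrix.mul_assoc, key, ← Matrix.mul_assoc, h, ← Matrix.mul_assoc]
      congr 2
      ext i j; fin_cases i <;> fin_cases j <;> simp
    · right
      rw [Matrix.mul_assoc, key, ← Matrix.mul_assoc, h, ← Matrix.mul_assoc]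

abbrev F2 := FreeGroup (Fin 2)
abbrev G3 := GL (Fin 3) ℂ

theorem adj_comm (g : G3) (N : M3) (h : (g : M3) * N = N * g) :
    (g : M3) * N.adjugate = N.adjugate * g := by
  have h1 := congrArg adjugate h
  rw [adjugate_mul_distrib, adjugate_mul_distrib] at h1
  have hd : (g : M3).det ≠ 0 := g.det.ne_zero
  have h2 : (g : M3) * (N.adjugate * (g : M3).adjugate) * g
      = (g : M3) * ((g : M3).adjugate * N.adjugate) * g := by rw [h1]
  rw [← Matrix.mul_assoc (g : M3) (g : M3).adjugate, mul_adjugate, Matrix.mul_assoc,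
    Matrix.mul_assoc, adjugate_mul] at h2
  simp only [Matrix.mul_smul, Matrix.smul_mul, Matrix.mul_one, Matrix.one_mul] at h2
  exact smul_right_injective _ hd h2

/-- A nonscalar matrix produces a rank one matrix in its double commutant. -/
theorem double (M : M3) (h : ∀ l : ℂ, M ≠ l • 1) :
    ∃ R : M3, R ≠ 0 ∧ R.adjugate = 0 ∧
      ∀ g : G3, (g : M3) * M = M * g → (g : M3) * R = R * g := by
  obtain ⟨l, hl⟩ := Module.End.exists_eigenvalue (Matrix.toLin' M)
  have hdet : (M - l • (1 : M3)).det = 0 := by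
    obtain ⟨v, hv⟩ := hl.exists_hasEigenvector
    apply Matrix.exists_mulVec_eq_zero_iff.mp
    refine ⟨v, hv.2, ?_⟩
    have := hv.apply_eq_smul
    rw [Matrix.toLin'_apply] at this
    rw [Matrix.sub_mulVec, this, Matrix.smul_mulVec, Matrix.one_mulVec, sub_self]
  have hN : M - l • (1 : M3) ≠ 0 := sub_ne_zero.mpr (h l)
  have hc : ∀ g : G3, (g : M3) * M = M * g →
      (g : M3) * (M - l • (1 : M3)) = (M - l • (1 : M3)) * g := by
    intro g hg
    simp [Matrix.mul_sub, Matrix.sub_mul, hg]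
  by_cases ha : (M - l • (1 : M3)).adjugate = 0
  · exact ⟨_, hN, ha, hc⟩
  · refine ⟨_, ha, ?_, fun g hg => adj_comm g _ (hc g hg)⟩
    rw [adjugate_adjugate _ (by simp), hdet]
    simp

theorem ent {A B : M3} (h : A = B) (i j : Fin 3) : A i j = B i j := by rw [h]

theorem tri_of_comm (g : M3) (h : g * E02 = E02 * g) :
    g 1 0 = 0 ∧ g 2 0 = 0 ∧ g 2 1 = 0 := by
  have h1 := ent h 1 2
  have h2 := ent h 2 2
  have h3 := ent h 0 1
  simp [mul_apply, Fin.sum_univ_three] at h1 h2 h3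
  exact ⟨h1, h2, h3.symm⟩

theorem blk_of_comm (g : M3) (h : g * E00 = E00 * g) :
    g 1 0 = 0 ∧ g 2 0 = 0 ∧ g 0 1 = 0 ∧ g 0 2 = 0 := by
  have h1 := ent h 1 0
  have h2 := ent h 2 0
  have h3 := ent h 0 1
  have h4 := ent h 0 2
  simp [mul_apply, Fin.sum_univ_three] at h1 h2 h3 h4
  exact ⟨h1, h2, h3.symm, h4.symm⟩

theorem unitri (C X Y : M3) (h : C * (Y * X) = X * Y) 
    (hC : C 1 0 = 0 ∧ C 2 0 = 0 ∧ C 2 1 = 0)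
    (hX : X 1 0 = 0 ∧ X 2 0 = 0 ∧ X 2 1 = 0)
    (hY : Y 1 0 = 0 ∧ Y 2 0 = 0 ∧ Y 2 1 = 0)
    (dX : X.det ≠ 0) (dY : Y.det ≠ 0) : C 0 0 = 1 ∧ C 1 1 = 1 ∧ C 2 2 = 1 := by
  obtain ⟨c1, c2, c3⟩ := hC
  obtain ⟨x1, x2, x3⟩ := hX
  obtain ⟨y1, y2, y3⟩ := hY
  have h1 := ent h 0 0
  have h2 := ent h 1 1
  have h3 := ent h 2 2
  simp [mul_apply, Fin.sum_univ_three, c1, c2, c3, x1, x2, x3, y1, y2, y3] at h1 h2 h3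
  simp [det_fin_three, x1, x2, x3, y1, y2, y3] at dX dY
  obtain ⟨⟨a1, a2⟩, a3⟩ := dX
  obtain ⟨⟨b1, b2⟩, b3⟩ := dY
  refine ⟨mul_right_cancel₀ (mul_ne_zero b1 a1) ?_, mul_right_cancel₀ (mul_ne_zero b2 a2) ?_,
    mul_right_cancel₀ (mul_ne_zero b3 a3) ?_⟩
  · linear_combination h1
  · linear_combination h2
  · linear_combination h3

theorem hom_rel (f : F2 →* G3) {a b c d : F2} (h : a * (b * c) = d) :
    (f a : M3) * ((f b : M3) * (f c : M3)) = (f d : M3) := by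
  rw [← h]; simp

theorem hom_mul (f : F2 →* G3) (a b : F2) :
    (f (a * b) : M3) = (f a : M3) * (f b : M3) := by simp

theorem det_ne (g : G3) : (g : M3).det ≠ 0 := g.det.ne_zero

theorem tri_law (f : F2 →* G3) (hf : Function.Injective f)
    (h : ∀ g, (f g : M3) * E02 = E02 * (f g : M3)) : False := by
  have T := fun g => tri_of_comm _ (h g)
  have r1 := hom_rel f gr1
  have r2 := hom_rel f gr2
  have r3 := hom_rel f gr3
  rw [hom_mul] at r1 r2 r3
  have u1 := unitri _ _ _ r1 (T _) (T _) (T _) (det_ne _) (det_ne _)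
  have u2 := unitri _ _ _ r2 (T _) (T _) (T _) (det_ne _) (det_ne _)
  have u3 := unitri _ _ _ r3 (T _) (T _) (T _) (det_ne _) (det_ne _)
  apply gt4
  apply hf
  apply Units.ext
  rw [hom_mul, hom_mul]
  have Tc := T gc
  have Td := T gd
  have Te := T ge
  generalize (f gc : M3) = c at *
  generalize (f gd : M3) = d at *
  generalize (f ge : M3) = e at *
  clear r1 r2 T
  obtain ⟨c1, c2, c3⟩ := Tc
  obtain ⟨d1, d2, d3⟩ := Td
  obtain ⟨e1, e2, e3⟩ := Te
  obtain ⟨c4, c5, c6⟩ := u1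
  obtain ⟨d4, d5, d6⟩ := u2
  obtain ⟨e4, e5, e6⟩ := u3
  have h1 := ent r3 0 1
  have h2 := ent r3 1 2
  simp [mul_apply, Fin.sum_univ_three, c1, c2, c3, d1, d2, d3, e1, e2, e3, c4, c5, c6, d4, d5, d6, e4, e5, e6] at h1 h2
  have e7 : e 0 1 = 0 := by linear_combination h1
  have e8 : e 1 2 = 0 := by linear_combination h2
  ext i j; fin_cases i <;> fin_cases j <;>
    simp [mul_apply, Fin.sum_univ_three, c1, c2, c3, e1, e2, e3, c4, c5, c6, e4, e5, e6, e7, e8] <;> ring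

def cj (P : G3) (f : F2 →* G3) : F2 →* G3 := (MulAut.conj P).toMonoidHom.comp f

theorem cj_inj (P : G3) (f : F2 →* G3) (hf : Function.Injective f) :
    Function.Injective (cj P f) := (MulAut.conj P).injective.comp hf

theorem cj_apply (P : G3) (f : F2 →* G3) (g : F2) : cj P f g = P * f g * P⁻¹ := rfl

theorem cj_comm (P : G3) (f : F2 →* G3) (R E : M3) (hP : (P : M3) * R = E * P)
    (h : ∀ g, (f g : M3) * R = R * (f g : M3)) (g : F2) :
    (cj P f g : M3) * E = E * (cj P f g : M3) := by
  have hE : E = (P : M3) * R * ((P⁻¹ : G3) : M3) := by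
    rw [hP, Matrix.mul_assoc, ← Units.val_mul]; simp
  have i1 : ((P⁻¹ : G3) : M3) * (P : M3) = 1 := by rw [← Units.val_mul]; simp
  rw [cj_apply, hE, Units.val_mul, Units.val_mul]
  calc (P : M3) * f g * ((P⁻¹ : G3) : M3) * (P * R * ((P⁻¹ : G3) : M3)) 
      = P * f g * (((P⁻¹ : G3) : M3) * P) * R * ((P⁻¹ : G3) : M3) := by noncomm_ring
    _ = P * (f g * R) * ((P⁻¹ : G3) : M3) := by rw [i1]; noncomm_ring
    _ = P * R * (((P⁻¹ : G3) : M3) * P) * f g * ((P⁻¹ : G3) : M3) := by rw [i1, h]; noncomm_ring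
    _ = _ := by noncomm_ring

theorem nil_law (f : F2 →* G3) (hf : Function.Injective f) (R : M3) (hR : R ≠ 0)
    (hA : R.adjugate = 0) (hRR : R * R = 0)
    (h : ∀ g, (f g : M3) * R = R * (f g : M3)) : False := by
  obtain ⟨P, ⟨s, hs, hP⟩ | hP⟩ := nf R hR hA
  · have : (P : M3) * (R * R) = s • E00 * (s • E00) * P := by
      rw [← Matrix.mul_assoc, hP, Matrix.mul_assoc, hP, Matrix.mul_assoc]
    rw [hRR, Matrix.mul_zero] at this
    have h2 : (0 : M3) * ((P⁻¹ : G3) : M3) = s • E00 * (s • E00) := by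
      rw [this, Matrix.mul_assoc, ← Units.val_mul]; simp
    have := ent h2 0 0
    simp [mul_apply, Fin.sum_univ_three, hs] at this
  · exact tri_law (cj P f) (cj_inj P f hf) (cj_comm P f R _ hP h)

theorem blk_one (C X Y : M3) (h : C * (Y * X) = X * Y) 
    (hC : C 1 0 = 0 ∧ C 2 0 = 0 ∧ C 0 1 = 0 ∧ C 0 2 = 0)
    (hX : X 1 0 = 0 ∧ X 2 0 = 0 ∧ X 0 1 = 0 ∧ X 0 2 = 0)
    (hY : Y 1 0 = 0 ∧ Y 2 0 = 0 ∧ Y 0 1 = 0 ∧ Y 0 2 = 0)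
    (dX : X.det ≠ 0) (dY : Y.det ≠ 0) :
    C 0 0 = 1 ∧ C 1 1 * C 2 2 - C 1 2 * C 2 1 = 1 := by
  have hd := congrArg det h
  rw [det_mul, det_mul, det_mul, mul_comm Y.det] at hd
  have hd' : C.det = 1 := by
    apply mul_right_cancel₀ (mul_ne_zero dX dY)
    rw [hd, one_mul]
  obtain ⟨c1, c2, c3, c4⟩ := hC
  obtain ⟨x1, x2, x3, x4⟩ := hX
  obtain ⟨y1, y2, y3, y4⟩ := hY
  have h1 := ent h 0 0
  simp [mul_apply, Fin.sum_univ_three, c1, c2, c3, c4, x1, x2, x3, x4, y1, y2, y3, y4] at h1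
  have a1 : X 0 0 ≠ 0 := by
    intro h0; apply dX; simp [det_fin_three, h0, x3, x4]
  have b1 : Y 0 0 ≠ 0 := by
    intro h0; apply dY; simp [det_fin_three, h0, y3, y4]
  have c5 : C 0 0 = 1 := by
    apply mul_right_cancel₀ (mul_ne_zero b1 a1)
    linear_combination h1
  refine ⟨c5, ?_⟩
  simp [det_fin_three, c1, c2, c3, c4, c5] at hd'
  exact hd'

theorem main_blk (f k : F2 →* G3) (hf : Function.Injective f) (hk : Function.Injective k)
    (hfk : ∀ a b, (f a : M3) * (k b : M3) = (k b : M3) * (f a : M3))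
    (h : ∀ g, (f g : M3) * E00 = E00 * (f g : M3))
    (h' : ∀ g, (k g : M3) * E00 = E00 * (k g : M3)) : False := by
  have T := fun g => blk_of_comm _ (h g)
  have T' := fun g => blk_of_comm _ (h' g)
  have r1 := hom_rel f gr1
  have r2 := hom_rel f gr2
  have r3 := hom_rel k gr1
  rw [hom_mul] at r1 r2 r3
  have u1 := blk_one _ _ _ r1 (T _) (T _) (T _) (det_ne _) (det_ne _)
  have u2 := blk_one _ _ _ r2 (T _) (T _) (T _) (det_ne _) (det_ne _)
  have u3 := blk_one _ _ _ r3 (T' _) (T' _) (T' _) (det_ne _) (det_ne _)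
  have n1 : (f gc : M3) * (f gd : M3) ≠ (f gd : M3) * (f gc : M3) := by
    rw [← hom_mul, ← hom_mul]
    exact fun hh => gt3 (hf (Units.ext hh))
  have n2 : (k gc : M3) * (k gc : M3) ≠ 1 := by
    rw [← hom_mul]
    intro hh
    refine gt2 (hk (Units.ext ?_))
    rw [hh]; simp
  have Tc := T gc
  have Td := T gd
  have Tb := T' gc
  have k1 := hfk gc gc
  have k2 := hfk gd gc
  clear r1 r2 r3 T T'
  generalize (f gc : M3) = c at *
  generalize (f gd : M3) = d at *
  generalize (k gc : M3) = b at *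
  obtain ⟨c1, c2, c3, c4⟩ := Tc
  obtain ⟨d1, d2, d3, d4⟩ := Td
  obtain ⟨b1, b2, b3, b4⟩ := Tb
  obtain ⟨c5, c6⟩ := u1
  obtain ⟨d5, d6⟩ := u2
  obtain ⟨b5, b6⟩ := u3
  have p1 := ent k1 1 1
  have p2 := ent k1 1 2
  have p3 := ent k1 2 1
  have q1 := ent k2 1 1
  have q2 := ent k2 1 2
  have q3 := ent k2 2 1
  simp [mul_apply, Fin.sum_univ_three, c1, c2, c3, c4, d1, d2, d3, d4, b1, b2, b3, b4] at p1 p2 p3 q1 q2 q3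
  by_cases s : b 1 2 = 0 ∧ b 2 1 = 0 ∧ b 1 1 = b 2 2
  · obtain ⟨s1, s2, s3⟩ := s
    apply n2
    have : b 2 2 * b 2 2 = 1 := by rw [s1, s3] at b6; linear_combination b6
    ext i j; fin_cases i <;> fin_cases j <;>
      simp [mul_apply, Fin.sum_univ_three, b1, b2, b3, b4, b5, s1, s2, s3, this]
  · apply n1
    have x1 : c 1 2 * d 2 1 = c 2 1 * d 1 2 := by grind
    have x2 : c 1 2 * (d 1 1 - d 2 2) = d 1 2 * (c 1 1 - c 2 2) := by grind
    have x3 : c 2 1 * (d 1 1 - d 2 2) = d 2 1 * (c 1 1 - c 2 2) := by grind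
    ext i j; fin_cases i <;> fin_cases j <;>
      simp [mul_apply, Fin.sum_univ_three, c1, c2, c3, c4, c5, d1, d2, d3, d4, d5]
    · linear_combination x1
    · linear_combination -x2
    · linear_combination x3
    · linear_combination -x1

theorem main_half (f k : F2 →* G3) (hf : Function.Injective f) (hk : Function.Injective k)
    (hfk : ∀ a b, (f a : M3) * (k b : M3) = (k b : M3) * (f a : M3))
    (h : ∀ g, (f g : M3) * E00 = E00 * (f g : M3)) : False := by
  have T := fun g => blk_of_comm _ (h g)
  have r1 := hom_rel f gr1
  rw [hom_mul] at r1
  have u1 := blk_one _ _ _ r1 (T _) (T _) (T _) (det_ne _) (det_ne _)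
  have n1 : (f gc : M3) - 1 ≠ 0 := by
    intro hh
    refine gt1 (hf (Units.ext ?_))
    rw [sub_eq_zero.mp hh]; simp
  have Tc := T gc
  have k1 : ∀ g, (k g : M3) * ((f gc : M3) - 1) = ((f gc : M3) - 1) * (k g : M3) := by
    intro g
    rw [Matrix.mul_sub, Matrix.sub_mul, hfk]; simp
  clear r1 T
  generalize (f gc : M3) = c at *
  obtain ⟨c1, c2, c3, c4⟩ := Tc
  obtain ⟨c5, c6⟩ := u1
  have hadj : (c - 1).adjugate = ((c 1 1 - 1) * (c 2 2 - 1) - c 1 2 * c 2 1) • E00 := by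
    rw [adjugate_fin_three]
    ext i j; fin_cases i <;> fin_cases j <;> simp [c1, c2, c3, c4, c5]
  by_cases hD : (c 1 1 - 1) * (c 2 2 - 1) - c 1 2 * c 2 1 = 0
  · refine nil_law k hk (c - 1) n1 (by rw [hadj, hD, zero_smul]) ?_ k1
    ext i j; fin_cases i <;> fin_cases j <;>
      simp [mul_apply, Fin.sum_univ_three, c1, c2, c3, c4, c5] <;> grind
  · refine main_blk f k hf hk hfk h fun g => ?_
    have := adj_comm (k g) _ (k1 g)
    rw [hadj, Matrix.mul_smul, Matrix.smul_mul] at this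
    exact smul_right_injective _ hD this

theorem main_GL (f k : F2 →* G3) (hf : Function.Injective f) (hk : Function.Injective k)
    (hfk : ∀ a b, f a * k b = k b * f a) : False := by
  obtain ⟨R, hR, hA, hc⟩ := double (k gx : M3) (by
    intro l hl
    apply gt5
    apply hk
    apply Units.ext
    rw [hom_mul, hom_mul, hl]; simp)
  have hfR : ∀ g, (f g : M3) * R = R * (f g : M3) := fun g => hc _ (by
    rw [← Units.val_mul, hfk, Units.val_mul])
  obtain ⟨P, ⟨s, hs, hP⟩ | hP⟩ := nf R hR hA
  · have h := cj_comm P f R _ hP hfR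
    refine main_half (cj P f) (cj P k) (cj_inj P f hf) (cj_inj P k hk) ?_ ?_
    · intro a b
      rw [← Units.val_mul, ← Units.val_mul]
      congr 1
      change MulAut.conj P (f a) * MulAut.conj P (k b) = MulAut.conj P (k b) * MulAut.conj P (f a)
      rw [← map_mul, hfk, map_mul]
    · intro g
      have := h g
      rw [Matrix.mul_smul, Matrix.smul_mul] at this
      exact smul_right_injective _ hs this
  · exact tri_law (cj P f) (cj_inj P f hf) (cj_comm P f R _ hP hfR)

theorem no_prod (φ : F2 × F2 →* Matrix.SpecialLinearGroup (Fin 3) ℂ) (h : Function.Injective φ) :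
    False := by
  let t : Matrix.SpecialLinearGroup (Fin 3) ℂ →* G3 := Matrix.SpecialLinearGroup.toGL
  have ht : Function.Injective t := Matrix.SpecialLinearGroup.toGL_injective
  refine main_GL ((t.comp φ).comp (MonoidHom.inl F2 F2)) ((t.comp φ).comp (MonoidHom.inr F2 F2))
    ?_ ?_ ?_
  · exact (ht.comp h).comp (fun a b hab => by simpa using hab)
  · exact (ht.comp h).comp (fun a b hab => by simpa using hab)
  · intro a b
    simp only [MonoidHom.comp_apply, ← map_mul]
    simp

/-- nonzero vectors -/
abbrev V2 := {v : ℝ × ℝ // v ≠ 0}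
abbrev S2 := Matrix.SpecialLinearGroup (Fin 2) ℝ

theorem S2_det (g : S2) : g.1 0 0 * g.1 1 1 - g.1 0 1 * g.1 1 0 = 1 := by
  have := g.2
  rwa [det_fin_two] at this

instance actV2 : MulAction S2 V2 where
  smul g v := ⟨(g.1 0 0 * v.1.1 + g.1 0 1 * v.1.2, g.1 1 0 * v.1.1 + g.1 1 1 * v.1.2), by
    intro h
    apply v.2
    have d := S2_det g
    have h1 : g.1 0 0 * v.1.1 + g.1 0 1 * v.1.2 = 0 := congrArg Prod.fst h
    have h2 : g.1 1 0 * v.1.1 + g.1 1 1 * v.1.2 = 0 := congrArg Prod.snd h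
    refine Prod.ext ?_ ?_
    · change v.1.1 = 0
      linear_combination g.1 1 1 * h1 - g.1 0 1 * h2 - v.1.1 * d
    · change v.1.2 = 0
      linear_combination g.1 0 0 * h2 - g.1 1 0 * h1 - v.1.2 * d⟩
  one_smul v := by
    apply Subtype.ext
    change ((1 : Matrix (Fin 2) (Fin 2) ℝ) 0 0 * v.1.1 + (1 : Matrix (Fin 2) (Fin 2) ℝ) 0 1 * v.1.2,
      (1 : Matrix (Fin 2) (Fin 2) ℝ) 1 0 * v.1.1 + (1 : Matrix (Fin 2) (Fin 2) ℝ) 1 1 * v.1.2) = v.1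
    simp
  mul_smul g h v := by
    apply Subtype.ext
    change ((g.1 * h.1) 0 0 * v.1.1 + (g.1 * h.1) 0 1 * v.1.2,
      (g.1 * h.1) 1 0 * v.1.1 + (g.1 * h.1) 1 1 * v.1.2) =
      (g.1 0 0 * (h.1 0 0 * v.1.1 + h.1 0 1 * v.1.2) + g.1 0 1 * (h.1 1 0 * v.1.1 + h.1 1 1 * v.1.2),
       g.1 1 0 * (h.1 0 0 * v.1.1 + h.1 0 1 * v.1.2) + g.1 1 1 * (h.1 1 0 * v.1.1 + h.1 1 1 * v.1.2))
    simp only [mul_apply, Fin.sum_univ_two]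
    refine Prod.ext ?_ ?_ <;> simp only <;> ring

theorem smul_V2 (g : S2) (v : V2) : (g • v).1 =
  (g.1 0 0 * v.1.1 + g.1 0 1 * v.1.2, g.1 1 0 * v.1.1 + g.1 1 1 * v.1.2) := rfl

def sA : S2 := ⟨!![1, 2; 0, 1], by simp [det_fin_two]⟩
def sB : S2 := ⟨!![1, 0; 2, 1], by simp [det_fin_two]⟩

theorem sA_s (v : V2) : (sA • v).1 = (v.1.1 + 2 * v.1.2, v.1.2) := by
  rw [smul_V2]; simp only [sA]; simp
theorem sB_s (v : V2) : (sB • v).1 = (v.1.1, 2 * v.1.1 + v.1.2) := by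
  rw [smul_V2]; simp only [sB]; simp
theorem sA_i (v : V2) : (sA⁻¹ • v).1 = (v.1.1 - 2 * v.1.2, v.1.2) := by
  rw [smul_V2, Matrix.SpecialLinearGroup.coe_inv, adjugate_fin_two]
  simp only [sA]; simp; ring
theorem sB_i (v : V2) : (sB⁻¹ • v).1 = (v.1.1, v.1.2 - 2 * v.1.1) := by
  rw [smul_V2, Matrix.SpecialLinearGroup.coe_inv, adjugate_fin_two]
  simp only [sB]; simp; ring

theorem V2_ne (v : V2) : 0 < v.1.1 ^ 2 + v.1.2 ^ 2 := by
  by_contra! h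
  apply v.2
  refine Prod.ext ?_ ?_
  · change v.1.1 = 0; nlinarith [sq_nonneg v.1.1, sq_nonneg v.1.2]
  · change v.1.2 = 0; nlinarith [sq_nonneg v.1.1, sq_nonneg v.1.2]

def pX : Fin 2 → Set V2 := ![{v | v.1.2 ^ 2 ≤ v.1.1 * v.1.2},
  {v | v.1.1 ^ 2 < v.1.1 * v.1.2 ∨ v.1.1 = 0}]
def pY : Fin 2 → Set V2 := ![{v | v.1.1 * v.1.2 < - v.1.2 ^ 2},
  {v | v.1.1 ≠ 0 ∧ v.1.1 * v.1.2 ≤ - v.1.1 ^ 2}]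

theorem free_S2 : ∃ f : F2 →* S2, Function.Injective f := by
  refine ⟨FreeGroup.lift ![sA, sB], FreeGroup.injective_lift_of_ping_pong _ (α := V2) pX pY
    ?_ ?_ ?_ ?_ ?_ ?_⟩
  · intro i
    fin_cases i
    · exact ⟨⟨(1, 1), by simp⟩, by simp [pX]⟩
    · exact ⟨⟨(0, 1), by simp⟩, by simp [pX]⟩
  · have : Disjoint (pX 0) (pX 1) := by
      rw [Set.disjoint_left]
      intro v h1 h2
      have := V2_ne v
      simp [pX] at h1 h2
      rcases h2 with h2 | h2
      · nlinarith [sq_nonneg (v.1.1 - v.1.2)]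
      · rw [h2] at h1 this; nlinarith
    intro i j hij
    fin_cases i <;> fin_cases j
    · simp at hij
    · exact this
    · exact this.symm
    · simp at hij
  · have : Disjoint (pY 0) (pY 1) := by
      rw [Set.disjoint_left]
      intro v h1 h2
      simp [pY] at h1 h2
      nlinarith [sq_nonneg (v.1.1 + v.1.2)]
    intro i j hij
    fin_cases i <;> fin_cases j
    · simp at hij
    · exact this
    · exact this.symm
    · simp at hij
  · intro i j
    rw [Set.disjoint_left]
    intro v h1 h2
    have := V2_ne v
    fin_cases i <;> fin_cases j <;> simp [pX, pY] at h1 h2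
    · nlinarith [sq_nonneg v.1.2]
    · have := sq_pos_of_ne_zero h2.1
      nlinarith [sq_nonneg v.1.2]
    · rcases h1 with h1 | h1
      · nlinarith [sq_nonneg v.1.2, sq_nonneg v.1.1]
      · rw [h1] at h2; nlinarith [sq_nonneg v.1.2]
    · rcases h1 with h1 | h1
      · nlinarith [sq_nonneg v.1.2, sq_nonneg v.1.1]
      · exact h2.1 h1
  · intro i
    rintro _ ⟨v, hv, rfl⟩
    fin_cases i
    · change sA • v ∈ pX 0
      simp [pX, pY] at hv ⊢
      rw [sA_s]
      nlinarith
    · change sB • v ∈ pX 1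
      simp [pX, pY] at hv ⊢
      rw [sB_s]
      by_cases h : v.1.1 = 0
      · exact Or.inr h
      · left; have := hv h; nlinarith
  · intro i
    rintro _ ⟨v, hv, rfl⟩
    fin_cases i
    · change sA⁻¹ • v ∈ pY 0
      simp [pX, pY] at hv ⊢
      rw [sA_i]
      nlinarith
    · change sB⁻¹ • v ∈ pY 1
      simp [pX, pY] at hv ⊢
      rw [sB_i]
      exact ⟨hv.2, by nlinarith⟩

def emb : S2 →* Matrix.SpecialLinearGroup (Fin 3) ℂ where
  toFun g := ⟨!![(g.1 0 0 : ℂ), (g.1 0 1 : ℂ), 0; (g.1 1 0 : ℂ), (g.1 1 1 : ℂ), 0; 0, 0, 1], by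
    have := S2_det g
    simp [det_fin_three]
    exact_mod_cast this⟩
  map_one' := by
    apply Subtype.ext
    ext i j; fin_cases i <;> fin_cases j <;> simp
  map_mul' g h := by
    apply Subtype.ext
    change (!![(((g.1 * h.1) 0 0 : ℝ) : ℂ), (((g.1 * h.1) 0 1 : ℝ) : ℂ), 0;
        (((g.1 * h.1) 1 0 : ℝ) : ℂ), (((g.1 * h.1) 1 1 : ℝ) : ℂ), 0; 0, 0, 1] : M3) =
      !![(g.1 0 0 : ℂ), (g.1 0 1 : ℂ), 0; (g.1 1 0 : ℂ), (g.1 1 1 : ℂ), 0; 0, 0, 1] *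
      !![(h.1 0 0 : ℂ), (h.1 0 1 : ℂ), 0; (h.1 1 0 : ℂ), (h.1 1 1 : ℂ), 0; 0, 0, 1]
    ext i j; fin_cases i <;> fin_cases j <;> simp [mul_apply, Fin.sum_univ_two, Fin.sum_univ_three]

theorem emb_inj : Function.Injective emb := by
  intro g h hgh
  have H := fun i j => ent (congrArg Subtype.val hgh) i j
  apply Subtype.ext
  ext i j
  have h1 : ((g.1 0 0 : ℝ) : ℂ) = (h.1 0 0 : ℝ) := H 0 0
  have h2 : ((g.1 0 1 : ℝ) : ℂ) = (h.1 0 1 : ℝ) := H 0 1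
  have h3 : ((g.1 1 0 : ℝ) : ℂ) = (h.1 1 0 : ℝ) := H 1 0
  have h4 : ((g.1 1 1 : ℝ) : ℂ) = (h.1 1 1 : ℝ) := H 1 1
  rw [Complex.ofReal_inj] at h1 h2 h3 h4
  fin_cases i <;> fin_cases j
  · exact h1
  · exact h2
  · exact h3
  · exact h4

theorem no_F2_times_F2_in_SL3_C :
    (¬ ∃ f : (FreeGroup (Fin 2) × FreeGroup (Fin 2)) →* Matrix.SpecialLinearGroup (Fin 3) ℂ,
        Function.Injective f) ∧
      freeSubgroupRank (Matrix.SpecialLinearGroup (Fin 3) ℂ) = 1 := by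
  refine ⟨fun ⟨f, hf⟩ => no_prod f hf, le_antisymm ?_ ?_⟩
  · apply sSup_le
    rintro c ⟨n, rfl, f, hf⟩
    by_contra hn
    have hn : 1 < n := by
      have := not_le.mp hn
      exact_mod_cast this
    let t : F2 × F2 →* (Fin n → F2) :=
      { toFun := fun p i => if i.1 = 0 then p.1 else p.2
        map_one' := by ext1 i; simp
        map_mul' := fun p q => by ext1 i; by_cases h : i.1 = 0 <;> simp [h] }
    have ht : Function.Injective t := by
      intro p q h
      have h0 := congrFun h ⟨0, by omega⟩
      have h1 := congrFun h ⟨1, hn⟩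
      exact Prod.ext (by simpa [t] using h0) (by simpa [t] using h1)
    exact no_prod (f.comp t) (hf.comp ht)
  · apply le_sSup
    refine ⟨1, by simp, ?_⟩
    obtain ⟨f, hf⟩ := free_S2
    refine ⟨(emb.comp f).comp (Pi.evalMonoidHom _ 0), (emb_inj.comp hf).comp ?_⟩
    intro p q h
    ext1 i
    rw [Subsingleton.elim i 0]
    exact h
end
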